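/- arXiv:2105.07307 — 5 statements merged into one kernel-verified Lean document; each statement's English description precedes it below -/
import Mathlib

section
/- Let m = x_{i_1}⋯x_{i_s} be a square-free monomial with i_1 < i_2 < ⋯ < i_s, and let T(m) = (t_0, t_1, …, t_k) and IT(m) = (i_{t_0}, i_{t_1}, …, i_{t_k}). Then: (1) s = t_0 > t_1 > ⋯ > t_k ≥ 1; (2) i_{t_0} > i_{t_1} > ⋯ > i_{t_k}; and (3) i_{t_j} − t_j > i_{t_{j+1}} − t_{j+1} for every j = 0, …, k−1. -/
open MvPolynomial

namespace SFB

/-- `B` is obtained from `A` by a single Borel move, where `A`, `B` are the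
(1-based) supports of square-free monomials: some index `i ∈ A` is replaced
by an index `j` with `1 ≤ j < i` not already in `A`. -/
def BorelMove (A B : Finset ℕ) : Prop :=
  ∃ i ∈ A, ∃ j, 1 ≤ j ∧ j < i ∧ j ∉ A ∧ B = insert j (A.erase i)

/-- `B` is obtained from `A` by finitely many Borel moves (possibly none). -/
def BorelReach (A B : Finset ℕ) : Prop :=
  Relation.ReflTransGen BorelMove A B

/-- The square-free monomial `∏_{r ∈ A} x_r` in `K[x_1,…,x_n]`,
where the variable `x_r` (for `1 ≤ r ≤ n`) is `X ⟨r-1,_⟩`. -/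
noncomputable def sqfMon (K : Type*) [Field K] (n : ℕ) (A : Finset ℕ) :
    MvPolynomial (Fin n) K :=
  ∏ j : Fin n, if (j : ℕ) + 1 ∈ A then X j else 1

/-- The square-free principal Borel ideal generated by the square-free
monomial with (1-based) support `A`, inside `K[x_1,…,x_n]`. -/
noncomputable def sfBorel (K : Type*) [Field K] (n : ℕ) (A : Finset ℕ) :
    Ideal (MvPolynomial (Fin n) K) :=
  Ideal.span {f | ∃ B, BorelReach A B ∧ f = sqfMon K n B}

/-- `α(J)`: the least degree of a nonzero homogeneous element of `J`. -/
noncomputable def alpha {K : Type*} [Field K] {n : ℕ}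
    (J : Ideal (MvPolynomial (Fin n) K)) : ℕ :=
  sInf {d | ∃ f ∈ J, f ≠ 0 ∧ MvPolynomial.IsHomogeneous f d}

/-- The `s`-th symbolic power of `I`: the intersection of the `s`-th powers
of the minimal primes of `I`. -/
noncomputable def symbPow {R : Type*} [CommRing R] (I : Ideal R) (s : ℕ) :
    Ideal R :=
  ⨅ P ∈ I.minimalPrimes, P ^ s

/-- The Waldschmidt constant `ᾱ(I) = inf_{s ≥ 1} α(I^{(s)})/s`
(which equals `lim_{s→∞} α(I^{(s)})/s`). -/
noncomputable def waldschmidt {K : Type*} [Field K] {n : ℕ}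
    (I : Ideal (MvPolynomial (Fin n) K)) : ℝ :=
  ⨅ s : ℕ+, (alpha (symbPow I (s : ℕ)) : ℝ) / ((s : ℕ) : ℝ)

/-- `t 0, t 1, …, t k` is the sequence `T(m)` associated to the square-free
monomial `m = x_{i 1} ⋯ x_{i s}` (with `i` strictly increasing on `1,…,s`):
`t 0 = s`, and for `1 ≤ j ≤ k`, `t j = max { r < t (j-1) | i r < i (r+1) - 1 }`,
with `k` the last index for which this maximum exists. -/
def IsTSeq (s : ℕ) (i : ℕ → ℕ) (t : ℕ → ℕ) (k : ℕ) : Prop :=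
  t 0 = s ∧
  (∀ j, 1 ≤ j → j ≤ k →
    1 ≤ t j ∧ t j < t (j - 1) ∧ i (t j) + 1 < i (t j + 1) ∧
    ∀ r, t j < r → r < t (j - 1) → ¬ (i r + 1 < i (r + 1))) ∧
  (∀ r, 1 ≤ r → r < t k → ¬ (i r + 1 < i (r + 1)))

end SFB

open SFB in
/-- Lemma 2.4: basic properties of `T(m)` and `IT(m)`. -/
theorem statement0 (s k : ℕ) (i t : ℕ → ℕ)
    (hs : 1 ≤ s)
    (hmono : ∀ r, 1 ≤ r → r < s → i r < i (r + 1))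
    (hT : IsTSeq s i t k) :
    (t 0 = s ∧ (∀ j, j < k → t (j + 1) < t j) ∧ 1 ≤ t k) ∧
    (∀ j, j < k → i (t (j + 1)) < i (t j)) ∧
    (∀ j, j < k → (i (t (j + 1)) : ℤ) - (t (j + 1) : ℤ) < (i (t j) : ℤ) - (t j : ℤ)) := by
  obtain ⟨h0, h1, h2⟩ := hT
  have hlt : ∀ j, j < k → t (j + 1) < t j := fun j hj => by
    simpa using (h1 (j + 1) (by omega) (by omega)).2.1
  have hle : ∀ j, j ≤ k → t j ≤ s := by
    intro j
    induction j with
    | zero => intro _; omega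
    | succ j ih =>
      intro hj
      have := ih (by omega)
      have := hlt j (by omega)
      omega
  have hpos : ∀ j, j < k → 1 ≤ t (j + 1) := fun j hj =>
    (h1 (j + 1) (by omega) (by omega)).1
  have key : ∀ a, 1 ≤ a → ∀ d, a + d ≤ s → i a + d ≤ i (a + d) := by
    intro a ha d
    induction d with
    | zero => intro _; simp
    | succ d ih =>
      intro hd
      have e1 := ih (by omega)
      have e2 := hmono (a + d) (by omega) (by omega)
      rw [← add_assoc a d 1]
      omega
  have main : ∀ j, j < k → i (t (j + 1)) + t j < i (t j) + t (j + 1) := by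
    intro j hj
    have e1 := (h1 (j + 1) (by omega) (by omega)).2.2.1
    have e2 := hlt j hj
    have e3 := hle j (by omega)
    have e4 := key (t (j + 1) + 1) (by omega) (t j - (t (j + 1) + 1)) (by omega)
    rw [show t (j + 1) + 1 + (t j - (t (j + 1) + 1)) = t j by omega] at e4
    omega
  refine ⟨⟨h0, hlt, ?_⟩, ?_, ?_⟩
  · rcases Nat.eq_zero_or_pos k with hk | hk
    · subst hk; omega
    · exact (h1 k hk le_rfl).1
  · intro j hj
    have := main j hj
    have := hlt j hj
    omega
  · intro j hj
    have := main j hj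
    omega
end

section
/- Let m = x_{i_1}⋯x_{i_s} be a square-free monomial in S = K[x_1,…,x_n] with i_1 < ⋯ < i_s ≤ n, with T(m) = (t_0,…,t_k), IT(m) = (i_{t_0},…,i_{t_k}), and ℓ the unique index with i_{t_{ℓ+1}} < t_0 ≤ i_{t_ℓ} (convention i_{t_{k+1}} = 0). Let I = sfBorel(m). Suppose y = (y_1,…,y_n) ∈ ℝ^n satisfies: (1) y_{t_j} + y_{t_j+1} + ⋯ + y_{i_{t_j}} ≥ 1 for each j = 0,…,k; (2) y_j ≥ y_{j+1} for all 1 ≤ j < i_{t_ℓ}; and (3) y_{i_{t_ℓ}} ≥ y_j for all i_{t_ℓ} ≤ j ≤ n. Then for every minimal prime P of I one has Σ_{r : x_r ∈ P} y_r ≥ 1. -/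
open MvPolynomial

namespace SFB

/-- The dominance criterion for Borel reachability. -/
theorem reach_of_dom (N : ℕ) : ∀ A B : Finset ℕ, (A \ B).card = N → A.card = B.card →
    (∀ b ∈ B, 1 ≤ b) →
    (∀ x, (B.filter (x < ·)).card ≤ (A.filter (x < ·)).card) → BorelReach A B := by
  induction N with
  | zero =>
    intro A B h0 hc _ _
    have : A ⊆ B := by simpa [Finset.sdiff_eq_empty_iff_subset] using h0
    rw [Finset.eq_of_subset_of_card_le this hc.ge]
    exact Relation.ReflTransGen.refl
  | succ N ih =>
    intro A B hN hc hpos hdom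
    have hBA : (B \ A).card = N + 1 := by
      rw [← hN]
      exact Finset.card_sdiff_comm hc.symm
    have hne : (B \ A).Nonempty := Finset.card_pos.mp (by omega)
    obtain ⟨j, hj, hjmax⟩ := Finset.exists_max_image (B \ A) id hne
    simp only [Finset.mem_sdiff, id] at hj hjmax
    have hj1 := hpos j hj.1
    obtain ⟨a, haA, haB, hja⟩ : ∃ a ∈ A, a ∉ B ∧ j < a := by
      by_contra! hcon
      have hsub : A.filter (j - 1 < ·) ⊂ B.filter (j - 1 < ·) := by
        rw [Finset.ssubset_iff_of_subset]
        · refine ⟨j, ?_, ?_⟩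
          · simp only [Finset.mem_filter]; exact ⟨hj.1, by omega⟩
          · simp [hj.2]
        · intro x hx
          simp only [Finset.mem_filter] at hx ⊢
          refine ⟨?_, hx.2⟩
          by_contra hxB
          have := hcon x hx.1 hxB
          have hxj : x = j := by omega
          exact hj.2 (hxj ▸ hx.1)
      have := Finset.card_lt_card hsub
      have := hdom (j - 1)
      omega
    have hstep : BorelMove A (insert j (A.erase a)) :=
      ⟨a, haA, j, hj1, hja, hj.2, rfl⟩
    have hjE : j ∉ A.erase a := fun h => hj.2 (Finset.mem_of_mem_erase h)
    refine Relation.ReflTransGen.head hstep (ih _ B ?_ ?_ hpos ?_)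
    · have : insert j (A.erase a) \ B = (A \ B).erase a := by
        ext x
        simp only [Finset.mem_sdiff, Finset.mem_insert, Finset.mem_erase]
        constructor
        · rintro ⟨rfl | h, h'⟩
          · exact absurd hj.1 h'
          · exact ⟨h.1, h.2, h'⟩
        · rintro ⟨h, h', h''⟩
          exact ⟨Or.inr ⟨h, h'⟩, h''⟩
      rw [this, Finset.card_erase_of_mem (by simp [haA, haB]), hN]
      rfl
    · rw [Finset.card_insert_of_notMem hjE, Finset.card_erase_of_mem haA, ← hc]
      have := Finset.card_pos.mpr ⟨a, haA⟩
      omega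
    · intro x
      by_cases hxj : x < j
      · have : (insert j (A.erase a)).filter (x < ·)
            = insert j ((A.filter (x < ·)).erase a) := by
          ext z
          simp only [Finset.mem_filter, Finset.mem_insert, Finset.mem_erase]
          constructor
          · rintro ⟨rfl | h, h'⟩
            · exact Or.inl rfl
            · exact Or.inr ⟨h.1, h.2, h'⟩
          · rintro (rfl | h)
            · exact ⟨Or.inl rfl, hxj⟩
            · exact ⟨Or.inr ⟨h.1, h.2.1⟩, h.2.2⟩
        have haF : a ∈ A.filter (x < ·) := by
          simp only [Finset.mem_filter]; exact ⟨haA, by omega⟩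
        rw [this, Finset.card_insert_of_notMem (by simp [hj.2]), Finset.card_erase_of_mem haF]
        have := Finset.card_pos.mpr ⟨a, haF⟩
        have := hdom x
        omega
      · by_cases hxa : x < a
        · apply Finset.card_le_card
          intro z hz
          simp only [Finset.mem_filter, Finset.mem_insert, Finset.mem_erase] at hz ⊢
          refine ⟨Or.inr ⟨?_, ?_⟩, hz.2⟩
          · rintro rfl; exact haB hz.1
          · by_contra hzA
            have := hjmax z ⟨hz.1, hzA⟩
            omega
        · refine (hdom x).trans (Finset.card_le_card ?_)
          intro z hz
          simp only [Finset.mem_filter, Finset.mem_insert, Finset.mem_erase] at hz ⊢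
          exact ⟨Or.inr ⟨by omega, hz.1⟩, hz.2⟩

/-- Borel moves can only increase the number of elements up to `x`. -/
theorem reach_count (x : ℕ) {A B : Finset ℕ} (h : BorelReach A B) :
    (∀ a ∈ A, 1 ≤ a) →
    (∀ b ∈ B, 1 ≤ b) ∧ (A.filter (· ≤ x)).card ≤ (B.filter (· ≤ x)).card := by
  intro hA
  induction h with
  | refl => exact ⟨hA, le_rfl⟩
  | @tail C D _ hm ih =>
    obtain ⟨a, haC, j, hj1, hja, hjC, rfl⟩ := hm
    refine ⟨?_, ih.2.trans ?_⟩
    · intro b hb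
      simp only [Finset.mem_insert, Finset.mem_erase] at hb
      rcases hb with rfl | hb
      · exact hj1
      · exact ih.1 b hb.2
    · by_cases hax : a ≤ x
      · have haF : a ∈ C.filter (· ≤ x) := by simp [haC, hax]
        have hsub : insert j ((C.filter (· ≤ x)).erase a)
            ⊆ (insert j (C.erase a)).filter (· ≤ x) := by
          intro z hz
          simp only [Finset.mem_filter, Finset.mem_insert, Finset.mem_erase] at hz ⊢
          rcases hz with rfl | h
          · exact ⟨Or.inl rfl, by omega⟩
          · exact ⟨Or.inr ⟨h.1, h.2.1⟩, h.2.2⟩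
        have := Finset.card_le_card hsub
        rw [Finset.card_insert_of_notMem (by simp [hjC]), Finset.card_erase_of_mem haF] at this
        omega
      · apply Finset.card_le_card
        intro z hz
        simp only [Finset.mem_filter, Finset.mem_insert, Finset.mem_erase] at hz ⊢
        exact ⟨Or.inr ⟨by omega, hz.1⟩, hz.2⟩

/-- Strict monotonicity of `i` on `[1,s]`. -/
theorem i_lt {s : ℕ} {i : ℕ → ℕ} (hmono : ∀ r, 1 ≤ r → r < s → i r < i (r + 1))
    {a b : ℕ} (ha : 1 ≤ a) (hab : a < b) (hb : b ≤ s) : i a < i b := by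
  induction b, hab using Nat.le_induction with
  | base => exact hmono a ha (by omega)
  | succ c hc ih => exact (ih (by omega)).trans (hmono c (by omega) (by omega))

theorem i_le {s : ℕ} {i : ℕ → ℕ} (hmono : ∀ r, 1 ≤ r → r < s → i r < i (r + 1))
    {a b : ℕ} (ha : 1 ≤ a) (hab : a ≤ b) (hb : b ≤ s) : i a ≤ i b := by
  rcases hab.eq_or_lt with rfl | h
  · exact le_rfl
  · exact (i_lt hmono ha h hb).le

theorem i_inj {s : ℕ} {i : ℕ → ℕ} (hmono : ∀ r, 1 ≤ r → r < s → i r < i (r + 1)) :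
    Set.InjOn i (Finset.Icc 1 s : Finset ℕ) := by
  intro a ha b hb hab
  simp only [Finset.coe_Icc, Set.mem_Icc] at ha hb
  rcases lt_trichotomy a b with h | h | h
  · have := i_lt hmono ha.1 h hb.2; omega
  · exact h
  · have := i_lt hmono hb.1 h ha.2; omega

/-- A set `Q` meeting every reachable set contains many elements of some `[1, i r]`. -/
theorem exists_good {s : ℕ} {i : ℕ → ℕ}
    (hmono : ∀ r, 1 ≤ r → r < s → i r < i (r + 1))
    (Q : Finset ℕ) (hQpos : ∀ q ∈ Q, 1 ≤ q)
    (hQ : ∀ B, BorelReach ((Finset.Icc 1 s).image i) B → ∃ q ∈ B, q ∈ Q) :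
    ∃ r, 1 ≤ r ∧ r ≤ s ∧ i r + 1 ≤ (Q.filter (· ≤ i r)).card + r := by
  classical
  by_contra! hcon
  let p : ℕ → Prop := fun x => 1 ≤ x ∧ x ∉ Q
  have hinf : (Set.ofPred p).Infinite := by
    have : Set.ofPred p = ((insert 0 Q : Finset ℕ) : Set ℕ)ᶜ := by
      ext x
      simp only [Set.mem_ofPred_eq, p, Set.mem_compl_iff, Finset.mem_coe, Finset.mem_insert, not_or]
      constructor
      · rintro ⟨h, h'⟩; exact ⟨by omega, h'⟩
      · rintro ⟨h, h'⟩; exact ⟨by omega, h'⟩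
    rw [this]
    exact Set.Finite.infinite_compl (Finset.finite_toSet _)
  have hb : ∀ r, 1 ≤ r → r ≤ s → Nat.nth p (r - 1) ≤ i r := by
    intro r hr1 hrs
    have := hcon r hr1 hrs
    refine Nat.lt_succ_iff.mp (Nat.nth_lt_of_lt_count ?_)
    rw [Nat.count_eq_card_filter_range]
    have h1 : (Finset.range (i r).succ).filter p = Finset.Icc 1 (i r) \ Q.filter (· ≤ i r) := by
      ext x
      simp only [Finset.mem_filter, Finset.mem_range, Finset.mem_sdiff, Finset.mem_Icc, p]
      constructor
      · rintro ⟨h, h', h''⟩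
        exact ⟨⟨h', by omega⟩, fun h => h'' h.1⟩
      · rintro ⟨⟨h, h'⟩, h''⟩
        exact ⟨by omega, h, fun hq => h'' ⟨hq, h'⟩⟩
    have h2 : Q.filter (· ≤ i r) ⊆ Finset.Icc 1 (i r) := by
      intro x hx
      simp only [Finset.mem_filter, Finset.mem_Icc] at hx ⊢
      exact ⟨hQpos x hx.1, hx.2⟩
    rw [h1, Finset.card_sdiff_of_subset h2, Nat.card_Icc]
    omega
  have hinjb : Set.InjOn (fun r => Nat.nth p (r - 1)) (Finset.Icc 1 s : Finset ℕ) := by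
    intro a ha b hb hab
    simp only [Finset.coe_Icc, Set.mem_Icc] at ha hb
    have := Nat.nth_injective hinf hab
    omega
  have hreach : BorelReach ((Finset.Icc 1 s).image i)
      ((Finset.Icc 1 s).image fun r => Nat.nth p (r - 1)) := by
    refine reach_of_dom _ _ _ rfl ?_ ?_ ?_
    · rw [Finset.card_image_of_injOn (i_inj hmono), Finset.card_image_of_injOn hinjb]
    · intro b hb
      obtain ⟨r, -, rfl⟩ := Finset.mem_image.mp hb
      exact (Nat.nth_mem_of_infinite hinf _).1
    · intro x
      rw [Finset.filter_image, Finset.filter_image, Finset.card_image_of_injOn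
        ((i_inj hmono).mono (by exact_mod_cast Finset.filter_subset _ _)), Finset.card_image_of_injOn
        (hinjb.mono (by exact_mod_cast Finset.filter_subset _ _))]
      apply Finset.card_le_card
      intro r hr
      simp only [Finset.mem_filter, Finset.mem_Icc] at hr ⊢
      exact ⟨hr.1, hr.2.trans_le (hb r hr.1.1 hr.1.2)⟩
  obtain ⟨q, hqB, hqQ⟩ := hQ _ hreach
  obtain ⟨r, -, rfl⟩ := Finset.mem_image.mp hqB
  exact (Nat.nth_mem_of_infinite hinf _).2 hqQ

theorem t_bounds {s : ℕ} {i t : ℕ → ℕ} {k : ℕ} (hs : 1 ≤ s) (hT : IsTSeq s i t k) :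
    ∀ j, j ≤ k → 1 ≤ t j ∧ t j ≤ s := by
  intro j
  induction j with
  | zero => intro _; rw [hT.1]; omega
  | succ j ih =>
    intro hj
    have := ih (by omega)
    have h := hT.2.1 (j + 1) (by omega) hj
    simp only [Nat.add_sub_cancel] at h
    omega

/-- Every gap occurs in the sequence `T(m)`. -/
theorem gap_mem {s : ℕ} {i t : ℕ → ℕ} {k : ℕ} (hT : IsTSeq s i t k) {r : ℕ}
    (hr1 : 1 ≤ r) (hrs : r ≤ s) (hgap : r < s → i r + 1 < i (r + 1)) :
    ∃ j, j ≤ k ∧ t j = r := by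
  by_contra! hcon
  have key : ∀ j, j ≤ k → r < t j := by
    intro j
    induction j with
    | zero =>
      intro h
      have := hcon 0 h
      rw [hT.1] at this ⊢
      omega
    | succ j ih =>
      intro hj
      have h0 := ih (by omega)
      have h := hT.2.1 (j + 1) (by omega) hj
      simp only [Nat.add_sub_cancel] at h
      have hne := hcon (j + 1) hj
      by_contra hlt
      have h0s : r < s := by
        rcases hrs.eq_or_lt with h' | h'
        · exfalso
          have hjj := hcon 0 (by omega)
          rw [hT.1] at hjj
          omega
        · exact h'
      exact h.2.2.2 r (by omega) h0 (hgap h0s)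
  have h0s : r < s := by have := key 0 (by omega); rwa [hT.1] at this
  exact hT.2.2 r hr1 (key k le_rfl) (hgap h0s)

/-- The numerical comparison. -/
theorem sum_compare {t N : ℕ} (y : ℕ → ℝ) (F : Finset ℕ)
    (hF : F ⊆ Finset.Icc 1 N) (hcard : F.card = (Finset.Icc t N).card)
    (hlo : ∀ a, 1 ≤ a → a < t → y t ≤ y a) (hhi : ∀ b, t ≤ b → b ≤ N → y b ≤ y t) :
    ∑ r ∈ Finset.Icc t N, y r ≤ ∑ r ∈ F, y r := by
  rw [← Finset.sum_sdiff_le_sum_sdiff]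
  have hc : (Finset.Icc t N \ F).card = (F \ Finset.Icc t N).card :=
    Finset.card_sdiff_comm hcard.symm
  calc ∑ r ∈ Finset.Icc t N \ F, y r ≤ (Finset.Icc t N \ F).card • y t := by
        apply Finset.sum_le_card_nsmul
        intro x hx
        simp only [Finset.mem_sdiff, Finset.mem_Icc] at hx
        exact hhi x hx.1.1 hx.1.2
    _ = (F \ Finset.Icc t N).card • y t := by rw [hc]
    _ ≤ ∑ r ∈ F \ Finset.Icc t N, y r := by
        apply Finset.card_nsmul_le_sum
        intro x hx
        simp only [Finset.mem_sdiff, Finset.mem_Icc] at hx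
        have := Finset.mem_Icc.mp (hF hx.1)
        exact hlo x this.1 (by omega)

/-- If `F` meets every generator and its variables lie in the minimal prime `P`, then the variables
in `P` are exactly those of `F`. -/
theorem minimal_vars {K : Type*} [Field K] {n : ℕ} {A : Finset ℕ}
    {P : Ideal (MvPolynomial (Fin n) K)} (hP : P ∈ (sfBorel K n A).minimalPrimes)
    (F : Finset ℕ) (hFP : ∀ j : Fin n, (j : ℕ) + 1 ∈ F → (X j : MvPolynomial (Fin n) K) ∈ P)
    (hF : ∀ B, BorelReach A B → ∃ j : Fin n, (j : ℕ) + 1 ∈ B ∧ (j : ℕ) + 1 ∈ F) (j : Fin n) :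
    (X j : MvPolynomial (Fin n) K) ∈ P ↔ (j : ℕ) + 1 ∈ F := by
  refine ⟨fun hj => ?_, hFP j⟩
  let φ : MvPolynomial (Fin n) K →ₐ[K] MvPolynomial (Fin n) K :=
    aeval (fun j : Fin n => if (j : ℕ) + 1 ∈ F then 0 else X j)
  have hφX : ∀ j, φ (X j) = if (j : ℕ) + 1 ∈ F then 0 else X j := fun j => by simp [φ]
  have hprime : (RingHom.ker φ).IsPrime := RingHom.ker_isPrime _
  have hI : sfBorel K n A ≤ RingHom.ker φ := by
    rw [sfBorel, Ideal.span_le]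
    rintro f ⟨B, hB, rfl⟩
    obtain ⟨j, hjB, hjF⟩ := hF B hB
    have h1 : (X j : MvPolynomial (Fin n) K) ∣ sqfMon K n B := by
      have := Finset.dvd_prod_of_mem
        (fun j : Fin n => if (j : ℕ) + 1 ∈ B then (X j : MvPolynomial (Fin n) K) else 1)
        (Finset.mem_univ j)
      simpa [hjB, sqfMon] using this
    refine Ideal.mem_of_dvd _ h1 ?_
    rw [RingHom.mem_ker, hφX, if_pos hjF]
  have hle : RingHom.ker φ ≤ P := by
    have hcomp : (Ideal.Quotient.mkₐ K P).comp φ = Ideal.Quotient.mkₐ K P := by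
      apply MvPolynomial.algHom_ext
      intro j
      rw [AlgHom.comp_apply, hφX]
      split_ifs with h
      · rw [map_zero]
        exact (Ideal.Quotient.eq_zero_iff_mem.mpr (hFP j h)).symm
      · rfl
    intro f hf
    rw [RingHom.mem_ker] at hf
    have h2 := congrArg (fun g => g f) hcomp
    simp only [AlgHom.comp_apply] at h2
    rw [show φ f = 0 from hf, map_zero] at h2
    exact Ideal.Quotient.eq_zero_iff_mem.mp h2.symm
  have hker := hP.2 ⟨hprime, hI⟩ hle hj
  rw [RingHom.mem_ker, hφX] at hker
  by_contra hcon
  rw [if_neg hcon] at hker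
  exact X_ne_zero j hker

end SFB

open SFB in
open scoped Classical in
/-- Lemma 3.3: if `y ∈ ℝ^n` satisfies the three listed conditions, then for
every minimal prime `P` of `sfBorel(m)` we have `∑_{r : x_r ∈ P} y_r ≥ 1`. -/
theorem statement3 (K : Type*) [Field K] (n s k ℓ : ℕ) (i t : ℕ → ℕ) (y : ℕ → ℝ)
    (hs : 1 ≤ s)
    (hmono : ∀ r, 1 ≤ r → r < s → i r < i (r + 1))
    (h1 : 1 ≤ i 1) (hn : i s ≤ n)
    (hT : IsTSeq s i t k)
    (hℓk : ℓ ≤ k)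
    (hℓ1 : t 0 ≤ i (t ℓ))
    (hℓ2 : ℓ < k → i (t (ℓ + 1)) < t 0)
    (hy1 : ∀ j, j ≤ k → 1 ≤ ∑ r ∈ Finset.Icc (t j) (i (t j)), y r)
    (hy2 : ∀ j, 1 ≤ j → j < i (t ℓ) → y (j + 1) ≤ y j)
    (hy3 : ∀ j, i (t ℓ) ≤ j → j ≤ n → y j ≤ y (i (t ℓ)))
    (P : Ideal (MvPolynomial (Fin n) K))
    (hP : P ∈ (sfBorel K n ((Finset.Icc 1 s).image i)).minimalPrimes) :
    1 ≤ ∑ j : Fin n, if MvPolynomial.X j ∈ P then y ((j : ℕ) + 1) else 0 := by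
  have hPprime : P.IsPrime := hP.1.1
  have hIP : sfBorel K n ((Finset.Icc 1 s).image i) ≤ P := hP.1.2
  set A := (Finset.Icc 1 s).image i with hA
  have hApos : ∀ a ∈ A, 1 ≤ a := by
    intro a ha
    obtain ⟨r, hr, rfl⟩ := Finset.mem_image.mp ha
    rw [Finset.mem_Icc] at hr
    exact h1.trans (i_le hmono le_rfl hr.1 hr.2)
  let Q : Finset ℕ := (Finset.univ.filter
    fun j : Fin n => (X j : MvPolynomial (Fin n) K) ∈ P).image fun j : Fin n => (j : ℕ) + 1
  have hQmem : ∀ q, q ∈ Q ↔ ∃ j : Fin n, (X j : MvPolynomial (Fin n) K) ∈ P ∧ (j : ℕ) + 1 = q := by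
    intro q; simp [Q]
  have hgood := exists_good hmono Q (fun q hq => by
      obtain ⟨j, -, rfl⟩ := (hQmem q).1 hq; omega) (by
      intro B hB
      have hmem : sqfMon K n B ∈ P := hIP (Ideal.subset_span ⟨B, hB, rfl⟩)
      rw [sqfMon, Ideal.IsPrime.prod_mem_iff] at hmem
      obtain ⟨j, -, hj⟩ := hmem
      split_ifs at hj with h
      · exact ⟨_, h, (hQmem _).2 ⟨j, hj, rfl⟩⟩
      · exact absurd ((Ideal.eq_top_iff_one P).2 hj) hPprime.ne_top)
  -- a maximal good index
  obtain ⟨r, hr, hrmax⟩ := Finset.exists_max_image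
    ((Finset.Icc 1 s).filter fun r => i r + 1 ≤ (Q.filter (· ≤ i r)).card + r) id (by
      obtain ⟨r, a, b, c⟩ := hgood
      exact ⟨r, by simp only [Finset.mem_filter, Finset.mem_Icc]; exact ⟨⟨a, b⟩, c⟩⟩)
  simp only [Finset.mem_filter, Finset.mem_Icc, id] at hr hrmax
  obtain ⟨⟨hr1, hrs⟩, hrc⟩ := hr
  obtain ⟨j, hjk, hjr⟩ := gap_mem hT hr1 hrs (by
    intro hlt
    by_contra hng
    have hlt' := hmono r hr1 hlt
    have heq : i (r + 1) = i r + 1 := by omega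
    have hsub : (Q.filter (· ≤ i r)).card ≤ (Q.filter (· ≤ i (r + 1))).card := by
      apply Finset.card_le_card
      intro x hx
      simp only [Finset.mem_filter] at hx ⊢
      exact ⟨hx.1, by omega⟩
    have := hrmax (r + 1) ⟨⟨by omega, by omega⟩, by omega⟩
    omega)
  have hri : r ≤ i r := by
    have : ∀ r, 1 ≤ r → r ≤ s → r ≤ i r := by
      intro r hr
      induction r, hr using Nat.le_induction with
      | base => intro _; exact h1
      | succ c hc ih =>
        intro h
        have := ih (by omega)
        have := hmono c hc (by omega)
        omega
    exact this r hr1 hrs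
  have hin : i r ≤ n := (i_le hmono hr1 hrs le_rfl).trans hn
  obtain ⟨F, hFQ, hFc⟩ := Finset.exists_subset_card_eq
    (show i r + 1 - r ≤ (Q.filter (· ≤ i r)).card by omega)
  have hFIcc : F ⊆ Finset.Icc 1 (i r) := by
    intro x hx
    have := Finset.mem_filter.mp (hFQ hx)
    obtain ⟨j, -, rfl⟩ := (hQmem x).1 this.1
    rw [Finset.mem_Icc]
    exact ⟨by omega, this.2⟩
  have hvars := minimal_vars hP F (by
      intro j hj
      obtain ⟨j', hj', he⟩ := (hQmem _).1 (Finset.mem_filter.mp (hFQ hj)).1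
      have : j' = j := Fin.ext (by omega)
      exact this ▸ hj') (by
      intro B hB
      obtain ⟨hBpos, hBc⟩ := reach_count (i r) hB hApos
      have hAc : r ≤ (A.filter (· ≤ i r)).card := by
        have hsub : (Finset.Icc 1 r).image i ⊆ A.filter (· ≤ i r) := by
          intro x hx
          obtain ⟨z, hz, rfl⟩ := Finset.mem_image.mp hx
          rw [Finset.mem_Icc] at hz
          rw [Finset.mem_filter]
          exact ⟨Finset.mem_image_of_mem _ (Finset.mem_Icc.2 ⟨hz.1, by omega⟩),
            i_le hmono hz.1 hz.2 hrs⟩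
        have := Finset.card_le_card hsub
        rw [Finset.card_image_of_injOn ((i_inj hmono).mono (by
          simpa using Set.Icc_subset_Icc_right hrs)), Nat.card_Icc] at this
        omega
      have hnd : ¬ Disjoint (B.filter (· ≤ i r)) F := by
        intro hd
        have hsub : B.filter (· ≤ i r) ∪ F ⊆ Finset.Icc 1 (i r) := by
          apply Finset.union_subset _ hFIcc
          intro x hx
          rw [Finset.mem_filter] at hx
          exact Finset.mem_Icc.2 ⟨hBpos x hx.1, hx.2⟩
        have := Finset.card_le_card hsub
        rw [Finset.card_union_of_disjoint hd, Nat.card_Icc] at this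
        omega
      obtain ⟨x, hxB, hxF⟩ := Finset.not_disjoint_iff.mp hnd
      have hx := Finset.mem_Icc.mp (hFIcc hxF)
      refine ⟨⟨x - 1, by omega⟩, ?_, ?_⟩
      · simpa [Nat.sub_add_cancel hx.1] using (Finset.mem_filter.mp hxB).1
      · simpa [Nat.sub_add_cancel hx.1] using hxF)
  have hanti : ∀ a b, 1 ≤ a → a ≤ b → b ≤ i (t ℓ) → y b ≤ y a := by
    intro a b ha hab
    induction b, hab using Nat.le_induction with
    | base => intro _; exact le_rfl
    | succ c hc ih =>
      intro h
      exact (hy2 c (by omega) (by omega)).trans (ih (by omega))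
  have hsl : s ≤ i (t ℓ) := hT.1 ▸ hℓ1
  have hsum : ∑ r ∈ Finset.Icc r (i r), y r ≤ ∑ r ∈ F, y r := by
    refine sum_compare y F hFIcc (by rw [hFc, Nat.card_Icc]) ?_ ?_
    · intro a ha har
      exact hanti a r ha har.le (by omega)
    · intro b hrb hbi
      by_cases hb : b ≤ i (t ℓ)
      · exact hanti r b hr1 hrb hb
      · exact (hy3 b (by omega) (by omega)).trans (hanti r _ hr1 (by omega) le_rfl)
  have hone := hy1 j hjk
  rw [hjr] at hone
  refine (hone.trans hsum).trans (le_of_eq ?_)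
  simp only [hvars]
  rw [← Finset.sum_filter]
  symm
  refine Finset.sum_bij (fun j _ => (j : ℕ) + 1) ?_ ?_ ?_ ?_
  · intro a ha; simpa using ha
  · intro a _ b _ hab; exact Fin.ext (by simpa using hab)
  · intro x hxF
    have hx := Finset.mem_Icc.mp (hFIcc hxF)
    refine ⟨⟨x - 1, by omega⟩, ?_, ?_⟩
    · simpa [Nat.sub_add_cancel hx.1] using hxF
    · simp [Nat.sub_add_cancel hx.1]
  · intro a _; rfl
end

section
/- Let m = x_{i_1}⋯x_{i_s} be a square-free monomial in S = K[x_1,…,x_n] with i_1 < ⋯ < i_s ≤ n, with T(m) = (t_0,…,t_k), IT(m) = (i_{t_0},…,i_{t_k}), and ℓ the unique index with i_{t_{ℓ+1}} < t_0 ≤ i_{t_ℓ} (convention i_{t_{k+1}} = 0). Let I = sfBorel(m). Then ᾱ(I) ≤ (t_0 − t_ℓ)/(i_{t_ℓ} − t_ℓ + 1) + Σ_{j=ℓ}^{k−1} (i_{t_j} − i_{t_{j+1}})/(i_{t_j} − t_j + 1) + i_{t_k}/(i_{t_k} − t_k + 1). -/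
open MvPolynomial

namespace SFB

/-- A dominated strictly increasing sequence is reachable by Borel moves. -/
theorem reach_of_le (s : ℕ) (i b : ℕ → ℕ)
    (hi : ∀ r r', 1 ≤ r → r < r' → r' ≤ s → i r < i r')
    (hb : ∀ r r', 1 ≤ r → r < r' → r' ≤ s → b r < b r')
    (hb1 : ∀ r, 1 ≤ r → r ≤ s → 1 ≤ b r)
    (hle : ∀ r, 1 ≤ r → r ≤ s → b r ≤ i r) :
    BorelReach ((Finset.Icc 1 s).image i) ((Finset.Icc 1 s).image b) := by
  have key : ∀ q, q ≤ s → BorelReach ((Finset.Icc 1 s).image i)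
      ((Finset.Icc 1 s).image (fun r => if r ≤ q then b r else i r)) := by
    intro q
    induction q with
    | zero =>
      intro _
      have : (Finset.Icc 1 s).image (fun r => if r ≤ 0 then b r else i r)
          = (Finset.Icc 1 s).image i := by
        apply Finset.image_congr
        intro r hr
        simp only [Finset.coe_Icc, Set.mem_Icc] at hr
        have : ¬ r ≤ 0 := by omega
        simp only [this, if_false]
      rw [this]
      exact Relation.ReflTransGen.refl
    | succ q ih =>
      intro hq
      have h0 := ih (by omega)
      rcases (hle (q+1) (by omega) hq).eq_or_lt with he | hlt
      · have : (Finset.Icc 1 s).image (fun r => if r ≤ q + 1 then b r else i r)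
          = (Finset.Icc 1 s).image (fun r => if r ≤ q then b r else i r) := by
          apply Finset.image_congr
          intro r hr
          rcases lt_trichotomy r (q+1) with h | h | h
          · simp only [h.le, Nat.lt_succ_iff.mp h, if_true]
          · subst h; simp [he]
          · have h1 : ¬ r ≤ q + 1 := by omega
            have h2 : ¬ r ≤ q := by omega
            simp only [h1, h2, if_false]
        rw [this]; exact h0
      · refine Relation.ReflTransGen.tail h0 ?_
        refine ⟨i (q+1), ?_, b (q+1), hb1 _ (by omega) hq, hlt, ?_, ?_⟩
        · rw [Finset.mem_image]
          exact ⟨q+1, Finset.mem_Icc.mpr ⟨by omega, hq⟩, by simp⟩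
        · rw [Finset.mem_image]
          rintro ⟨r, hr, hre⟩
          rw [Finset.mem_Icc] at hr
          split_ifs at hre with h
          · have := hb r (q+1) hr.1 (by omega) hq
            omega
          · rcases (show q + 1 ≤ r by omega).eq_or_lt with h' | h'
            · subst h'; omega
            · have := hi (q+1) r (by omega) h' hr.2
              omega
        · ext x
          simp only [Finset.mem_image, Finset.mem_insert, Finset.mem_erase, Finset.mem_Icc]
          constructor
          · rintro ⟨r, hr, rfl⟩
            rcases lt_trichotomy r (q+1) with h | h | h
            · right
              have h2 : r ≤ q := by omega
              simp only [h.le, if_true]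
              refine ⟨?_, r, hr, by simp [h2]⟩
              have := hb r (q+1) hr.1 h hq
              omega
            · left; subst h; simp
            · right
              have h1 : ¬ r ≤ q + 1 := by omega
              have h2 : ¬ r ≤ q := by omega
              simp only [h1, if_false]
              refine ⟨?_, r, hr, by simp [h2]⟩
              have := hi (q+1) r (by omega) h hr.2
              omega
          · rintro (rfl | ⟨hne, r, hr, rfl⟩)
            · exact ⟨q+1, ⟨by omega, hq⟩, by simp⟩
            · refine ⟨r, hr, ?_⟩
              rcases lt_trichotomy r (q+1) with h | h | h
              · have h2 : r ≤ q := by omega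
                simp only [h.le, h2, if_true]
              · subst h; simp at hne
              · have h1 : ¬ r ≤ q + 1 := by omega
                have h2 : ¬ r ≤ q := by omega
                simp only [h1, h2, if_false]
  have := key s le_rfl
  have h2 : (Finset.Icc 1 s).image (fun r => if r ≤ s then b r else i r)
          = (Finset.Icc 1 s).image b := by
    apply Finset.image_congr
    intro r hr
    simp only [Finset.coe_Icc, Set.mem_Icc] at hr
    simp only [hr.2, if_true]
  rwa [h2] at this

/-- A prime containing the ideal contains many variables of some initial segment. -/
theorem prime_card (K : Type*) [Field K] (n s : ℕ) (i : ℕ → ℕ)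
    (hi : ∀ r r', 1 ≤ r → r < r' → r' ≤ s → i r < i r')
    (hn : ∀ r, 1 ≤ r → r ≤ s → i r ≤ n)
    (P : Ideal (MvPolynomial (Fin n) K)) (hP : P.IsPrime)
    (hle : sfBorel K n ((Finset.Icc 1 s).image i) ≤ P)
    (V : Finset ℕ) (hV : ∀ p, p ∈ V ↔ ∃ j : Fin n, (j : ℕ) + 1 = p ∧ X j ∈ P) :
    ∃ r, 1 ≤ r ∧ r ≤ s ∧ i r + 1 ≤ (V.filter (· ≤ i r)).card + r := by
  classical
  by_contra hcon
  push Not at hcon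
  obtain ⟨C, hC⟩ : ∃ C : ℕ → Prop, ∀ p, C p ↔ (1 ≤ p ∧ p ∉ V) := ⟨_, fun _ => Iff.rfl⟩
  have hCinf : (Set.ofPred C).Infinite := by
    have : Set.ofPred C = ((insert 0 V : Finset ℕ) : Set ℕ)ᶜ := by
      ext p
      simp only [Set.mem_ofPred_eq, hC, Finset.coe_insert, Set.mem_compl_iff, Set.mem_insert_iff,
        Finset.mem_coe, not_or]
      constructor
      · rintro ⟨h, h'⟩; exact ⟨by omega, h'⟩
      · rintro ⟨h, h'⟩; exact ⟨by omega, h'⟩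
    rw [this]
    exact (Finset.finite_toSet _).infinite_compl
  let b : ℕ → ℕ := fun r => Nat.nth C (r - 1)
  have hbC : ∀ r, 1 ≤ b r ∧ b r ∉ V := fun r => (hC _).1 (Nat.nth_mem_of_infinite hCinf _)
  have hreach : BorelReach ((Finset.Icc 1 s).image i) ((Finset.Icc 1 s).image b) := by
    apply reach_of_le s i b hi
    · intro r r' h1 h2 _
      exact Nat.nth_strictMono hCinf (by omega)
    · intro r _ _; exact (hbC r).1
    · intro r h1 h2
      have hc : r - 1 < Nat.count C (i r + 1) := by
        have h3 := hcon r h1 h2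
        rw [Nat.count_eq_card_filter_range]
        have h4 : Finset.Icc 1 (i r) ⊆
            (Finset.range (i r + 1)).filter (fun x => C x) ∪ V.filter (· ≤ i r) := by
          intro p hp
          rw [Finset.mem_Icc] at hp
          rw [Finset.mem_union, Finset.mem_filter, Finset.mem_filter, Finset.mem_range]
          by_cases hpV : p ∈ V
          · right; exact ⟨hpV, hp.2⟩
          · left; exact ⟨by omega, (hC p).2 ⟨hp.1, hpV⟩⟩
        have h5 := (Finset.card_le_card h4).trans (Finset.card_union_le _ _)
        rw [Nat.card_Icc] at h5
        omega
      have := Nat.nth_lt_of_lt_count hc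
      change Nat.nth C (r-1) ≤ i r
      omega
  have hmem : sqfMon K n ((Finset.Icc 1 s).image b) ∈ P :=
    hle (Ideal.subset_span ⟨_, hreach, rfl⟩)
  unfold sqfMon at hmem
  rw [hP.prod_mem_iff] at hmem
  obtain ⟨j, -, hj⟩ := hmem
  split_ifs at hj with h
  · rw [Finset.mem_image] at h
    obtain ⟨r, -, hr⟩ := h
    exact (hbC r).2 ((hV _).2 ⟨j, hr.symm, hj⟩)
  · exact hP.ne_top ((Ideal.eq_top_iff_one _).2 hj)

/-- A feasible weight gives an upper bound for the Waldschmidt constant. -/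
theorem wald_le (K : Type*) [Field K] (n s : ℕ) (i : ℕ → ℕ)
    (hi : ∀ r r', 1 ≤ r → r < r' → r' ≤ s → i r < i r')
    (hn : ∀ r, 1 ≤ r → r ≤ s → i r ≤ n) (N : ℕ) (hN : 0 < N) (w : ℕ → ℕ)
    (hw : ∀ V : Finset ℕ, ∀ r, 1 ≤ r → r ≤ s → (∀ p ∈ V, 1 ≤ p ∧ p ≤ i r) →
      i r + 1 ≤ V.card + r → N ≤ ∑ p ∈ V, w p) :
    waldschmidt (sfBorel K n ((Finset.Icc 1 s).image i)) ≤
      ((∑ p ∈ Finset.range n, w (p + 1) : ℕ) : ℝ) / N := by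
  classical
  set I := sfBorel K n ((Finset.Icc 1 s).image i) with hI
  have hbdd : BddBelow (Set.range fun q : ℕ+ =>
      (alpha (symbPow I (q : ℕ)) : ℝ) / ((q : ℕ) : ℝ)) :=
    ⟨0, by rintro _ ⟨q, rfl⟩; positivity⟩
  refine (ciInf_le hbdd ⟨N, hN⟩).trans ?_
  simp only [PNat.mk_coe]
  gcongr
  apply Nat.sInf_le
  refine ⟨∏ j : Fin n, X j ^ w (j + 1), ?_, ?_, ?_⟩
  · unfold symbPow
    simp only [Ideal.mem_iInf]
    intro P hP
    have hPp : P.IsPrime := hP.1.1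
    let U : Finset (Fin n) := Finset.univ.filter (fun j => (X j : MvPolynomial (Fin n) K) ∈ P)
    let e : Fin n ↪ ℕ := ⟨fun j => (j : ℕ) + 1, fun a b h => Fin.ext (by simpa using h)⟩
    let V : Finset ℕ := U.map e
    obtain ⟨r, h1, h2, h3⟩ := prime_card K n s i hi hn P hPp hP.1.2 V (by
      intro p
      simp only [V, U, e, Finset.mem_map, Finset.mem_filter, Finset.mem_univ, true_and,
        Function.Embedding.coeFn_mk]
      constructor
      · rintro ⟨j, h, h'⟩; exact ⟨j, h', h⟩
      · rintro ⟨j, h, h'⟩; exact ⟨j, h', h⟩)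
    have h4 := hw (V.filter (· ≤ i r)) r h1 h2 (by
      intro p hp
      rw [Finset.mem_filter] at hp
      refine ⟨?_, hp.2⟩
      obtain ⟨j, -, rfl⟩ := Finset.mem_map.1 hp.1
      exact Nat.succ_pos _) h3
    have h5 : ∑ p ∈ V.filter (· ≤ i r), w p ≤ ∑ p ∈ V, w p :=
      Finset.sum_le_sum_of_subset (Finset.filter_subset _ _)
    have h6 : ∑ p ∈ V, w p = ∑ j ∈ U, w (j + 1) := by
      simp only [V, Finset.sum_map]; rfl
    have h7 : ∏ j ∈ U, (X j : MvPolynomial (Fin n) K) ^ w (j + 1) ∈ P ^ N := by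
      have : ∏ j ∈ U, (X j : MvPolynomial (Fin n) K) ^ w (j + 1) ∈ ∏ j ∈ U, P ^ w (j + 1) := by
        apply Ideal.prod_mem_prod
        intro j hj
        exact Ideal.pow_mem_pow (Finset.mem_filter.1 hj).2 _
      rw [Finset.prod_pow_eq_pow_sum] at this
      exact Ideal.pow_le_pow_right (by omega) this
    rw [← Finset.prod_mul_prod_compl U]
    exact Ideal.mul_mem_right _ _ h7
  · rw [Finset.prod_ne_zero_iff]
    intro j _
    exact pow_ne_zero _ (X_ne_zero j)
  · rw [← Fin.sum_univ_eq_sum_range (fun p => w (p + 1)) n]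
    apply IsHomogeneous.prod
    intro j _
    simpa using (isHomogeneous_X K j).pow (w (j + 1))

end SFB

open SFB in
/-- Theorem 3.4: upper bound for the Waldschmidt constant of a square-free
principal Borel ideal. -/
theorem statement4 (K : Type*) [Field K] (n s k ℓ : ℕ) (i t : ℕ → ℕ)
    (hs : 1 ≤ s)
    (hmono : ∀ r, 1 ≤ r → r < s → i r < i (r + 1))
    (h1 : 1 ≤ i 1) (hn : i s ≤ n)
    (hT : IsTSeq s i t k)
    (hℓk : ℓ ≤ k)
    (hℓ1 : t 0 ≤ i (t ℓ))
    (hℓ2 : ℓ < k → i (t (ℓ + 1)) < t 0) :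
    waldschmidt (sfBorel K n ((Finset.Icc 1 s).image i)) ≤
      ((t 0 : ℝ) - (t ℓ : ℝ)) / ((i (t ℓ) : ℝ) - (t ℓ : ℝ) + 1)
      + ∑ j ∈ Finset.Ico ℓ k,
          ((i (t j) : ℝ) - (i (t (j + 1)) : ℝ)) / ((i (t j) : ℝ) - (t j : ℝ) + 1)
      + (i (t k) : ℝ) / ((i (t k) : ℝ) - (t k : ℝ) + 1) := by
  have hmono' : ∀ r r', 1 ≤ r → r < r' → r' ≤ s → i r + (r' - r) ≤ i r' := by
    intro r r' hr hlt hle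
    induction r', hlt using Nat.le_induction with
    | base => have := hmono r hr (by omega); simp; omega
    | succ q hq ih =>
      have h2 := ih (by omega)
      have h3 := hmono q (by omega) (by omega)
      omega
  have hmono'' : ∀ r r', 1 ≤ r → r ≤ r' → r' ≤ s → i r + r' ≤ i r' + r := by
    intro r r' hr hlt hle
    rcases hlt.eq_or_lt with rfl | h
    · omega
    · have := hmono' r r' hr h hle; omega
  have hir : ∀ r, 1 ≤ r → r ≤ s → r ≤ i r := by
    intro r h2 h3
    have := hmono'' 1 r le_rfl h2 h3
    omega
  obtain ⟨hT0, hT1, hT2⟩ := hT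
  have ht : ∀ j, j ≤ k → 1 ≤ t j ∧ t j ≤ s := by
    intro j
    induction j with
    | zero => intro _; omega
    | succ j ih =>
      intro hj
      have h2 := ih (by omega)
      have h3 := hT1 (j+1) (by omega) hj
      simp only [Nat.add_sub_cancel] at h3
      omega
  have hanti : ∀ j, j < k → t (j+1) < t j := by
    intro j hj
    have h3 := hT1 (j+1) (by omega) (by omega)
    simp only [Nat.add_sub_cancel] at h3
    omega
  -- denominators
  obtain ⟨d, hd⟩ : ∃ d : ℕ → ℕ, ∀ j, d j = i (t j) - t j + 1 := ⟨_, fun _ => rfl⟩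
  have hdt : ∀ j, j ≤ k → d j + t j = i (t j) + 1 := by
    intro j hj
    have := hir (t j) (ht j hj).1 (ht j hj).2
    rw [hd]; omega
  have hdpos : ∀ j, 0 < d j := fun j => by rw [hd]; omega
  obtain ⟨N, hNdef⟩ : ∃ N, N = ∏ j ∈ Finset.range (k+1), d j := ⟨_, rfl⟩
  have hN : 0 < N := by rw [hNdef]; exact Finset.prod_pos fun j _ => hdpos j
  obtain ⟨M, hMdef⟩ : ∃ M : ℕ → ℕ, ∀ j, M j = N / d j := ⟨_, fun _ => rfl⟩
  have hM : ∀ j, j ≤ k → d j * M j = N := by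
    intro j hj
    rw [hMdef]
    apply Nat.mul_div_cancel'
    rw [hNdef]
    exact Finset.dvd_prod_of_mem _ (Finset.mem_range.2 (by omega))
  have hMmono : ∀ j, j < k → M j ≤ M (j+1) := by
    intro j hj
    rw [hMdef, hMdef]
    apply Nat.div_le_div_left _ (hdpos _)
    have h2 := hmono'' (t (j+1)) (t j) (ht (j+1) (by omega)).1 (hanti j hj).le (ht j (by omega)).2
    have h3 := hdt j (by omega)
    have h4 := hdt (j+1) (by omega)
    omega
  have hIanti : ∀ j, ℓ ≤ j → j ≤ k → ∀ q, ℓ ≤ q → q ≤ j → i (t j) ≤ i (t q) := by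
    intro j hj hjk q _ hqj
    induction j, hqj using Nat.le_induction with
    | base => exact le_rfl
    | succ j hqj ih =>
      have h2 := ih (by omega) (by omega)
      have h3 := hmono'' (t (j+1)) (t j) (ht (j+1) (by omega)).1
        (hanti j (by omega)).le (ht j (by omega)).2
      have := hanti j (by omega)
      omega
  obtain ⟨L, hL⟩ : ∃ L, L = i (t ℓ) + (s - t ℓ) := ⟨_, rfl⟩
  have htℓ := ht ℓ hℓk
  have hLs : L ≤ i s := by
    have := hmono'' (t ℓ) s htℓ.1 htℓ.2 le_rfl
    omega
  have hLn : L ≤ n := hLs.trans hn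
  obtain ⟨w, hw⟩ : ∃ w : ℕ → ℕ, ∀ p, w p = (if p ≤ L then M ℓ else 0) +
    ∑ j ∈ Finset.Ico ℓ k, (if p ≤ i (t (j+1)) then M (j+1) - M j else 0) := ⟨_, fun _ => rfl⟩
  have hwj : ∀ j, ℓ ≤ j → j ≤ k → ∀ p, p ≤ i (t j) → M j ≤ w p := by
    intro j hj hjk p hp
    have hpL : p ≤ L := by
      have := hIanti j hj hjk ℓ le_rfl hj
      omega
    have hsub : ∑ q ∈ Finset.Ico ℓ j, (M (q+1) - M q) ≤
        ∑ q ∈ Finset.Ico ℓ k, (if p ≤ i (t (q+1)) then M (q+1) - M q else 0) := by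
      calc ∑ q ∈ Finset.Ico ℓ j, (M (q+1) - M q)
          = ∑ q ∈ Finset.Ico ℓ j, (if p ≤ i (t (q+1)) then M (q+1) - M q else 0) := by
            apply Finset.sum_congr rfl
            intro q hq
            rw [Finset.mem_Ico] at hq
            have := hIanti j hj hjk (q+1) (by omega) (by omega)
            rw [if_pos (by omega)]
        _ ≤ _ := Finset.sum_le_sum_of_subset (Finset.Ico_subset_Ico_right hjk)
    have htel : ∀ j, ℓ ≤ j → j ≤ k → M ℓ + ∑ q ∈ Finset.Ico ℓ j, (M (q+1) - M q) = M j := by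
      intro j hj
      induction j, hj using Nat.le_induction with
      | base => simp
      | succ j hj ih =>
        intro hjk
        rw [Finset.sum_Ico_succ_top hj, ← add_assoc, ih (by omega)]
        have := hMmono j (by omega)
        omega
    rw [hw, if_pos hpL]
    have := htel j hj hjk
    omega
  -- feasibility
  have hfeas : ∀ V : Finset ℕ, ∀ r, 1 ≤ r → r ≤ s → (∀ p ∈ V, 1 ≤ p ∧ p ≤ i r) →
      i r + 1 ≤ V.card + r → N ≤ ∑ p ∈ V, w p := by
    intro V r hr hrs hV hcard
    rcases lt_or_ge (t ℓ) r with hlt | hge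
    · have hcL : d ℓ ≤ (V.filter (· ≤ L)).card := by
        have h2 := hdt ℓ hℓk
        have h3 := hmono'' (t ℓ) r htℓ.1 hlt.le hrs
        have h4 : V ⊆ V.filter (· ≤ L) ∪ Finset.Ioc L (i r) := by
          intro p hp
          rw [Finset.mem_union, Finset.mem_filter, Finset.mem_Ioc]
          have := (hV p hp).2
          by_cases hpL : p ≤ L
          · exact Or.inl ⟨hp, hpL⟩
          · exact Or.inr ⟨by omega, this⟩
        have h5 := (Finset.card_le_card h4).trans (Finset.card_union_le _ _)
        rw [Nat.card_Ioc] at h5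
        omega
      calc N = d ℓ * M ℓ := (hM ℓ hℓk).symm
        _ ≤ (V.filter (· ≤ L)).card * M ℓ := Nat.mul_le_mul_right _ hcL
        _ = ∑ p ∈ V.filter (· ≤ L), M ℓ := by simp
        _ ≤ ∑ p ∈ V.filter (· ≤ L), w p := by
            apply Finset.sum_le_sum
            intro p hp
            rw [hw, if_pos (Finset.mem_filter.1 hp).2]
            omega
        _ ≤ ∑ p ∈ V, w p := Finset.sum_le_sum_of_subset (Finset.filter_subset _ _)
    · obtain ⟨j, hj, hjk, hrj, hjmax⟩ : ∃ j, ℓ ≤ j ∧ j ≤ k ∧ r ≤ t j ∧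
          (j < k → t (j+1) < r) := by
        by_contra hcon
        push Not at hcon
        have : ∀ j, ℓ ≤ j → j ≤ k → r ≤ t j := by
          intro j hj
          induction j, hj using Nat.le_induction with
          | base => intro _; exact hge
          | succ j hj ih =>
            intro hjk
            exact (hcon j hj (by omega) (ih (by omega))).2
        have := (hcon k hℓk le_rfl (this k hℓk le_rfl)).1
        omega
      have hnj : ∀ q, r ≤ q → q < t j → ¬ (i q + 1 < i (q+1)) := by
        intro q hq hqt
        rcases hjk.eq_or_lt with h | h
        · subst h; exact hT2 q (by omega) hqt
        · have h3 := (hT1 (j+1) (by omega) (by omega)).2.2.2 q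
          simp only [Nat.add_sub_cancel] at h3
          have := hjmax h
          exact h3 (by omega) hqt
      have hcons : ∀ q, r ≤ q → q ≤ t j → i q + r = i r + q := by
        intro q hq
        induction q, hq using Nat.le_induction with
        | base => intro _; rfl
        | succ q hq ih =>
          intro hqt
          have h2 := ih (by omega)
          have h3 := hnj q hq (by omega)
          have h4 := hmono q (by omega) (by have := ht j hjk; omega)
          omega
      have h5 := hcons (t j) hrj le_rfl
      have h6 := hdt j hjk
      have hdc : d j ≤ V.card := by omega
      calc N = d j * M j := (hM j hjk).symm
        _ ≤ V.card * M j := Nat.mul_le_mul_right _ hdc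
        _ = ∑ p ∈ V, M j := by simp
        _ ≤ ∑ p ∈ V, w p := by
            apply Finset.sum_le_sum
            intro p hp
            have := (hV p hp).2
            exact hwj j hj hjk p (by omega)
  have hmain := wald_le K n s i
    (fun r r' h2 h3 h4 => by have := hmono' r r' h2 h3 h4; omega)
    (fun r h2 h3 => by have := hmono'' r s h2 h3 le_rfl; omega) N hN w hfeas
  refine hmain.trans (le_of_eq ?_)
  have hcount : ∀ (c A : ℕ), A ≤ n →
      ∑ p ∈ Finset.range n, (if p + 1 ≤ A then c else 0) = A * c := by
    intro c A hA
    rw [← Finset.sum_filter]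
    have : (Finset.range n).filter (fun p => p + 1 ≤ A) = Finset.range A := by
      ext p
      simp only [Finset.mem_filter, Finset.mem_range]
      omega
    rw [this]; simp
  have hsum : ∑ p ∈ Finset.range n, w (p+1) =
      L * M ℓ + ∑ j ∈ Finset.Ico ℓ k, i (t (j+1)) * (M (j+1) - M j) := by
    simp only [hw]
    rw [Finset.sum_add_distrib, hcount _ _ hLn, Finset.sum_comm]
    congr 1
    apply Finset.sum_congr rfl
    intro j hj
    rw [Finset.mem_Ico] at hj
    apply hcount
    have h2 := hIanti (j+1) (by omega) (by omega) ℓ le_rfl (by omega)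
    omega
  have hNR : (0:ℝ) < N := by exact_mod_cast hN
  have hden : ∀ j, j ≤ k → (i (t j) : ℝ) - (t j : ℝ) + 1 = d j := by
    intro j hj
    have : (d j : ℝ) + t j = i (t j) + 1 := by exact_mod_cast hdt j hj
    linarith
  have hdiv : ∀ j, j ≤ k → ∀ x : ℝ, x / d j = x * M j / N := by
    intro j hj x
    have h2 : (d j : ℝ) * M j = N := by exact_mod_cast hM j hj
    have h3 : (0:ℝ) < d j := by exact_mod_cast hdpos j
    rw [div_eq_div_iff h3.ne' hNR.ne', ← h2]
    ring
  rw [hden ℓ hℓk, hden k le_rfl, hdiv ℓ hℓk, hdiv k le_rfl]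
  have hs2 : ∑ j ∈ Finset.Ico ℓ k,
          ((i (t j) : ℝ) - (i (t (j + 1)) : ℝ)) / ((i (t j) : ℝ) - (t j : ℝ) + 1) =
      (∑ j ∈ Finset.Ico ℓ k, ((i (t j) : ℝ) - (i (t (j + 1)) : ℝ)) * M j) / N := by
    rw [Finset.sum_div]
    apply Finset.sum_congr rfl
    intro j hj
    rw [Finset.mem_Ico] at hj
    rw [hden j (by omega), hdiv j (by omega)]
  rw [hs2, ← add_div, ← add_div, hsum]
  congr 1
  push_cast
  have hLR : (L : ℝ) = i (t ℓ) + (s - t ℓ) := by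
    rw [hL]; push_cast [Nat.cast_sub htℓ.2]; ring
  have hcast : ∑ j ∈ Finset.Ico ℓ k, (i (t (j+1)) : ℝ) * ((M (j+1) - M j : ℕ) : ℝ) =
      ∑ j ∈ Finset.Ico ℓ k, ((i (t j) : ℝ) - (i (t (j + 1)) : ℝ)) * M j +
      ∑ j ∈ Finset.Ico ℓ k, ((i (t (j+1)) : ℝ) * M (j+1) - (i (t j) : ℝ) * M j) := by
    rw [← Finset.sum_add_distrib]
    apply Finset.sum_congr rfl
    intro j hj
    rw [Finset.mem_Ico] at hj
    rw [Nat.cast_sub (hMmono j (by omega))]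
    ring
  have htel2 := Finset.sum_Ico_sub (fun j => (i (t j) : ℝ) * M j) hℓk
  rw [hcast, htel2, hLR, hT0]
  ring
end

section
/- Let i ≥ 1 and l ≥ 0 be integers with i + l ≤ n, and let I = sfBorel(x_i x_{i+1}⋯x_{i+l}) ⊆ S = K[x_1,…,x_n]. Then ᾱ(I) = (i + l)/i. -/
open MvPolynomial

namespace SFB

/-- Reachable sets keep their cardinality and stay in `[1, N]`. -/
lemma reach_props {N : ℕ} {A B : Finset ℕ} (h : BorelReach A B) (hA : A ⊆ Finset.Icc 1 N) :
    B.card = A.card ∧ B ⊆ Finset.Icc 1 N := by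
  induction h with
  | refl => exact ⟨rfl, hA⟩
  | tail _ hm ih =>
    obtain ⟨ihc, ihs⟩ := ih
    obtain ⟨a, ha, j, hj1, hja, hjn, rfl⟩ := hm
    constructor
    · rw [Finset.card_insert_of_notMem (by simp [hjn]), Finset.card_erase_of_mem ha, ← ihc]
      have := Finset.card_pos.mpr ⟨a, ha⟩
      omega
    · intro x hx
      rw [Finset.mem_insert] at hx
      have := ihs ha
      rcases hx with rfl | hx
      · rw [Finset.mem_Icc] at *
        omega
      · exact ihs (Finset.mem_of_mem_erase hx)

/-- Every subset of `[1, i+l]` of size `l+1` is reachable. -/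
lemma reach_all (i l : ℕ) : ∀ (k : ℕ) (B : Finset ℕ),
    (B \ Finset.Icc i (i + l)).card = k → B.card = l + 1 → B ⊆ Finset.Icc 1 (i + l) →
    BorelReach (Finset.Icc i (i + l)) B := by
  intro k
  induction k with
  | zero =>
    intro B hk hc _
    rw [Finset.card_eq_zero, Finset.sdiff_eq_empty_iff_subset] at hk
    have : B = Finset.Icc i (i + l) := by
      apply Finset.eq_of_subset_of_card_le hk
      rw [Nat.card_Icc, hc]
      omega
    rw [this]
    exact Relation.ReflTransGen.refl
  | succ k ih =>
    intro B hk hc hB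
    obtain ⟨j, hj⟩ : (B \ Finset.Icc i (i + l)).Nonempty := by
      rw [← Finset.card_pos]
      omega
    have hcA : (Finset.Icc i (i + l)).card = l + 1 := by
      rw [Nat.card_Icc]
      omega
    have h2 : ((Finset.Icc i (i + l)) \ B).card = k + 1 := by
      rw [Finset.card_sdiff_comm (by omega), hk]
    obtain ⟨a, ha⟩ : ((Finset.Icc i (i + l)) \ B).Nonempty := by
      rw [← Finset.card_pos]
      omega
    rw [Finset.mem_sdiff] at hj ha
    have hjB := Finset.mem_Icc.mp (hB hj.1)
    have hji : j < i := by
      by_contra hcon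
      exact hj.2 (Finset.mem_Icc.mpr ⟨by omega, hjB.2⟩)
    have haA := Finset.mem_Icc.mp ha.1
    have hne : a ≠ j := by omega
    have hstep : BorelMove (insert a (B.erase j)) B := by
      refine ⟨a, Finset.mem_insert_self _ _, j, hjB.1, by omega, ?_, ?_⟩
      · simp [hne.symm]
      · rw [Finset.erase_insert (by simp [ha.2]), Finset.insert_erase hj.1]
    refine Relation.ReflTransGen.tail (ih _ ?_ ?_ ?_) hstep
    · rw [Finset.insert_sdiff_of_mem _ ha.1, Finset.erase_sdiff_comm, Finset.card_erase_of_mem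
        (Finset.mem_sdiff.mpr hj), hk]
      rfl
    · rw [Finset.card_insert_of_notMem (by simp [ha.2]), Finset.card_erase_of_mem hj.1, hc]
      rfl
    · intro x hx
      rw [Finset.mem_insert] at hx
      rcases hx with rfl | hx
      · rw [Finset.mem_Icc]
        omega
      · exact hB (Finset.mem_of_mem_erase hx)

/-- Averaging: some `i`-subset has at most average weight. -/
lemma exists_small {σ : Type*} [DecidableEq σ] (w : σ → ℕ) (i : ℕ) (hi : 1 ≤ i) :
    ∀ (k : ℕ) (V : Finset σ), V.card = i + k →
    ∃ T ⊆ V, T.card = i ∧ (i + k) * ∑ j ∈ T, w j ≤ i * ∑ j ∈ V, w j := by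
  intro k
  induction k with
  | zero => exact fun V hV => ⟨V, subset_rfl, hV, le_rfl⟩
  | succ k ih =>
    intro V hV
    obtain ⟨a, ha, hmax⟩ := Finset.exists_max_image V w (Finset.card_pos.mp (by omega))
    have hc : (V.erase a).card = i + k := by
      rw [Finset.card_erase_of_mem ha]
      omega
    obtain ⟨T, hT, hTc, hTs⟩ := ih _ hc
    refine ⟨T, hT.trans (Finset.erase_subset _ _), hTc, ?_⟩
    have h1 : ∑ j ∈ V.erase a, w j ≤ (i + k) * w a := by
      rw [← hc, ← smul_eq_mul]
      exact Finset.sum_le_card_nsmul _ _ _ fun x hx => hmax x (Finset.mem_of_mem_erase hx)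
    have h2 := Finset.sum_erase_add V w ha
    rw [← h2]
    generalize ∑ j ∈ V.erase a, w j = S at *
    generalize ∑ j ∈ T, w j = t at *
    have hpos : 0 < i + k := by omega
    refine Nat.le_of_mul_le_mul_left ?_ hpos
    calc (i + k) * ((i + (k + 1)) * t) = (i + k + 1) * ((i + k) * t) := by ring
      _ ≤ (i + k + 1) * (i * S) := Nat.mul_le_mul_left _ hTs
      _ = i * ((i + k) * S + S) := by ring
      _ ≤ i * ((i + k) * S + (i + k) * w a) := by gcongr
      _ = (i + k) * (i * (S + w a)) := by ring

variable {K : Type*} [Field K] {n : ℕ}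

/-- Ideal generated by the variables in `T`. -/
noncomputable def PT (K : Type*) [Field K] {n : ℕ} (T : Finset (Fin n)) :
    Ideal (MvPolynomial (Fin n) K) :=
  Ideal.span (X '' (T : Set (Fin n)))

lemma PT_prime (T : Finset (Fin n)) : (PT K T).IsPrime := by
  classical
  let φ : MvPolynomial (Fin n) K →ₐ[K] MvPolynomial (Fin n) K :=
    aeval fun j => if j ∈ T then 0 else X j
  have hker : PT K T = RingHom.ker φ := by
    apply le_antisymm
    · rw [PT, Ideal.span_le]
      rintro _ ⟨j, hj, rfl⟩
      have hj' : j ∈ T := hj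
      simp [φ, RingHom.mem_ker, hj']
    · intro f hf
      have hcomp : (Ideal.Quotient.mkₐ K (PT K T)).comp φ = Ideal.Quotient.mkₐ K (PT K T) := by
        apply MvPolynomial.algHom_ext
        intro j
        by_cases hj : j ∈ T
        · simp only [φ, AlgHom.comp_apply, aeval_X, hj, if_true, map_zero]
          symm
          rw [Ideal.Quotient.mkₐ_eq_mk, Ideal.Quotient.eq_zero_iff_mem]
          exact Ideal.subset_span ⟨j, hj, rfl⟩
        · simp [φ, hj]
      have h := DFunLike.congr_fun hcomp f
      rw [AlgHom.comp_apply, (RingHom.mem_ker).mp hf, map_zero] at h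
      rw [← Ideal.Quotient.eq_zero_iff_mem]
      exact h.symm
  rw [hker]
  exact RingHom.ker_isPrime _

lemma PT_pow_le (T : Finset (Fin n)) (s : ℕ) :
    PT K T ^ s ≤ Ideal.span ((fun m => monomial m (1 : K)) ''
      {m : Fin n →₀ ℕ | s ≤ ∑ j ∈ T, m j}) := by
  induction s with
  | zero =>
    intro f _
    rw [mem_ideal_span_monomial_image]
    exact fun m _ => ⟨m, by simp, le_rfl⟩
  | succ s ih =>
    rw [pow_succ]
    refine (Ideal.mul_mono_left ih).trans ?_
    rw [PT, Ideal.span_mul_span', Ideal.span_le]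
    rintro _ ⟨_, ⟨m, hm, rfl⟩, _, ⟨j, hj, rfl⟩, rfl⟩
    apply Ideal.subset_span
    refine ⟨m + Finsupp.single j 1, ?_, ?_⟩
    · have hm' : s ≤ ∑ j ∈ T, m j := hm
      have hj' : j ∈ T := hj
      have h1 : ∑ x ∈ T, (Finsupp.single j 1 : Fin n →₀ ℕ) x = 1 := by
        simp [Finsupp.single_apply, hj']
      show s + 1 ≤ ∑ x ∈ T, (m + Finsupp.single j 1 : Fin n →₀ ℕ) x
      simp only [Finsupp.add_apply, Finset.sum_add_distrib, h1]
      omega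
    · simp [X, monomial_mul]

lemma PT_pow_weight {T : Finset (Fin n)} {s : ℕ} {f : MvPolynomial (Fin n) K}
    (hf : f ∈ PT K T ^ s) {m : Fin n →₀ ℕ} (hm : m ∈ f.support) : s ≤ ∑ j ∈ T, m j := by
  obtain ⟨m', hm', hle⟩ := mem_ideal_span_monomial_image.mp (PT_pow_le T s hf) m hm
  exact le_trans hm' (Finset.sum_le_sum fun j _ => hle j)

/-- The first `N` variables. -/
def firstVars (n N : ℕ) : Finset (Fin n) := Finset.univ.filter fun j => (j : ℕ) < N

lemma mem_firstVars {N : ℕ} {j : Fin n} : j ∈ firstVars n N ↔ (j : ℕ) < N := by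
  simp [firstVars]

lemma card_firstVars {N : ℕ} (h : N ≤ n) : (firstVars n N).card = N := by
  have : (firstVars n N).image (fun j : Fin n => (j : ℕ)) = Finset.range N := by
    ext x
    simp only [Finset.mem_image, mem_firstVars, Finset.mem_range]
    constructor
    · rintro ⟨j, hj, rfl⟩
      exact hj
    · exact fun hx => ⟨⟨x, by omega⟩, hx, rfl⟩
  rw [← Finset.card_image_of_injective _ Fin.val_injective, this, Finset.card_range]

lemma prime_mem_of_prod {σ R : Type*} [CommRing R] {P : Ideal R} (hP : P.IsPrime) (s : Finset σ)
    (g : σ → R) (h : ∏ j ∈ s, g j ∈ P) : ∃ j ∈ s, g j ∈ P := by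
  classical
  induction s using Finset.induction_on with
  | empty => exact absurd ((Ideal.eq_top_iff_one P).mpr (by simpa using h)) hP.ne_top
  | insert a s ha ih =>
    rw [Finset.prod_insert ha] at h
    rcases hP.mem_or_mem h with h | h
    · exact ⟨a, by simp, h⟩
    · obtain ⟨j, hj, hj'⟩ := ih h
      exact ⟨j, by simp [hj], hj'⟩

lemma sqfMon_eq (A : Finset ℕ) : sqfMon K n A =
    ∏ j ∈ Finset.univ.filter (fun j : Fin n => (j : ℕ) + 1 ∈ A), X j := by
  rw [sqfMon, Finset.prod_filter]

/-- A prime containing the ideal contains at least `i` of the first `i+l` variables. -/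
lemma prime_contains {i l : ℕ} (hn : i + l ≤ n)
    {P : Ideal (MvPolynomial (Fin n) K)} (hP : P.IsPrime)
    (hI : sfBorel K n (Finset.Icc i (i + l)) ≤ P) :
    ∃ T ⊆ firstVars n (i + l), T.card = i ∧ ∀ j ∈ T, (X j : MvPolynomial (Fin n) K) ∈ P := by
  classical
  set V := firstVars n (i + l) with hV
  have hVc : V.card = i + l := card_firstVars hn
  let W := V.filter fun j => (X j : MvPolynomial (Fin n) K) ∈ P
  by_cases hW : i ≤ W.card
  · obtain ⟨T, hT, hTc⟩ := Finset.exists_subset_card_eq hW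
    exact ⟨T, hT.trans (Finset.filter_subset _ _), hTc,
      fun j hj => (Finset.mem_filter.mp (hT hj)).2⟩
  · exfalso
    let W' := V.filter fun j => ¬ (X j : MvPolynomial (Fin n) K) ∈ P
    have hsum : W.card + W'.card = V.card := Finset.card_filter_add_card_filter_not _
    obtain ⟨U, hU, hUc⟩ := Finset.exists_subset_card_eq (show l + 1 ≤ W'.card by omega)
    let B : Finset ℕ := U.image fun j : Fin n => (j : ℕ) + 1
    have hinj : Function.Injective fun j : Fin n => (j : ℕ) + 1 := by
      intro a b hab
      apply Fin.ext
      simpa using hab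
    have hBc : B.card = l + 1 := by
      rw [Finset.card_image_of_injective _ hinj, hUc]
    have hBs : B ⊆ Finset.Icc 1 (i + l) := by
      intro x hx
      obtain ⟨j, hj, rfl⟩ := Finset.mem_image.mp hx
      have := mem_firstVars.mp (Finset.mem_filter.mp (hU hj)).1
      rw [Finset.mem_Icc]
      omega
    have hmem : sqfMon K n B ∈ P :=
      hI (Ideal.subset_span ⟨B, reach_all i l _ B rfl hBc hBs, rfl⟩)
    rw [sqfMon_eq] at hmem
    obtain ⟨j, hj, hjP⟩ := prime_mem_of_prod hP _ _ hmem
    obtain ⟨j', hj', he⟩ := Finset.mem_image.mp (Finset.mem_filter.mp hj).2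
    have : j' = j := hinj he
    subst this
    exact (Finset.mem_filter.mp (hU hj')).2 hjP

lemma le_PT {i l : ℕ} (hi : 1 ≤ i) (hn : i + l ≤ n) {T : Finset (Fin n)}
    (hT : T ⊆ firstVars n (i + l)) (hTc : T.card = i) :
    sfBorel K n (Finset.Icc i (i + l)) ≤ PT K T := by
  rw [sfBorel, Ideal.span_le]
  rintro _ ⟨B, hB, rfl⟩
  obtain ⟨hBc, hBs⟩ := reach_props (N := i + l) hB (Finset.Icc_subset_Icc_left hi)
  rw [Nat.card_Icc] at hBc
  have hex : ∃ j ∈ T, (j : ℕ) + 1 ∈ B := by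
    by_contra hcon
    push Not at hcon
    let T' : Finset ℕ := T.image fun j : Fin n => (j : ℕ) + 1
    have hinj : Function.Injective fun j : Fin n => (j : ℕ) + 1 := by
      intro a b hab
      apply Fin.ext
      simpa using hab
    have hT'c : T'.card = i := by
      rw [Finset.card_image_of_injective _ hinj, hTc]
    have hdis : Disjoint T' B := by
      rw [Finset.disjoint_left]
      intro x hx
      obtain ⟨j, hj, rfl⟩ := Finset.mem_image.mp hx
      exact hcon j hj
    have hsub : T' ∪ B ⊆ Finset.Icc 1 (i + l) := by
      refine Finset.union_subset ?_ hBs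
      intro x hx
      obtain ⟨j, hj, rfl⟩ := Finset.mem_image.mp hx
      have := mem_firstVars.mp (hT hj)
      rw [Finset.mem_Icc]
      omega
    have := Finset.card_le_card hsub
    rw [Finset.card_union_of_disjoint hdis, Nat.card_Icc] at this
    omega
  obtain ⟨j, hj, hjB⟩ := hex
  rw [SetLike.mem_coe, sqfMon_eq]
  refine Ideal.mem_of_dvd _ (Finset.dvd_prod_of_mem _ (by simp [hjB])) (?_ : X j ∈ PT K T)
  exact Ideal.subset_span ⟨j, hj, rfl⟩

lemma PT_minimal {i l : ℕ} (hi : 1 ≤ i) (hn : i + l ≤ n) {T : Finset (Fin n)}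
    (hT : T ⊆ firstVars n (i + l)) (hTc : T.card = i) :
    PT K T ∈ (sfBorel K n (Finset.Icc i (i + l))).minimalPrimes := by
  refine ⟨⟨PT_prime T, le_PT hi hn hT hTc⟩, ?_⟩
  rintro Q ⟨hQ, hIQ⟩ hQT
  obtain ⟨U, _, hUc, hUQ⟩ := prime_contains hn hQ hIQ
  have hUT : U ⊆ T := by
    intro j hj
    have h := hQT (hUQ j hj)
    rw [PT, mem_ideal_span_X_image] at h
    obtain ⟨a, ha, hne⟩ := h (Finsupp.single j 1) (by simp [support_X])
    rw [Finsupp.single_apply] at hne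
    have : j = a := by
      by_contra hja
      simp [hja] at hne
    rw [this]
    exact ha
  have hUT' : U = T := Finset.eq_of_subset_of_card_le hUT (by omega)
  subst hUT'
  rw [PT, Ideal.span_le]
  rintro _ ⟨j, hj, rfl⟩
  exact hUQ j hj

/-- The product of the first `N` variables. -/
noncomputable def bigMon (K : Type*) [Field K] (n N : ℕ) : MvPolynomial (Fin n) K :=
  ∏ j ∈ firstVars n N, X j

lemma bigMon_mem {i l : ℕ} (hn : i + l ≤ n) :
    bigMon K n (i + l) ∈ symbPow (sfBorel K n (Finset.Icc i (i + l))) i := by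
  classical
  simp only [symbPow, Ideal.mem_iInf]
  rintro P ⟨⟨hP, hI⟩, _⟩
  obtain ⟨T, hT, hTc, hTP⟩ := prime_contains hn hP hI
  refine Ideal.mem_of_dvd _ (Finset.prod_dvd_prod_of_subset _ _ _ hT) ?_
  have := Ideal.prod_mem_prod (I := fun _ : Fin n => P) hTP
  rwa [Finset.prod_const, hTc] at this

lemma bigMon_ne (N : ℕ) : bigMon K n N ≠ 0 :=
  Finset.prod_ne_zero_iff.mpr fun j _ => X_ne_zero j

lemma bigMon_hom {N : ℕ} (h : N ≤ n) : (bigMon K n N).IsHomogeneous N := by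
  have := IsHomogeneous.prod (firstVars n N) (fun j => (X j : MvPolynomial (Fin n) K))
    (fun _ => 1) (fun j _ => isHomogeneous_X K j)
  rwa [Finset.sum_const, card_firstVars h, smul_eq_mul, mul_one] at this

lemma alpha_lower {i l : ℕ} (hi : 1 ≤ i) (hn : i + l ≤ n) (s : ℕ) :
    (i + l) * s ≤ i * alpha (symbPow (sfBorel K n (Finset.Icc i (i + l))) s) := by
  classical
  have hne : {d | ∃ f ∈ symbPow (sfBorel K n (Finset.Icc i (i + l))) s,
      f ≠ 0 ∧ MvPolynomial.IsHomogeneous f d}.Nonempty := by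
    refine ⟨(i + l) * s, bigMon K n (i + l) ^ s, ?_, pow_ne_zero _ (bigMon_ne _),
      (bigMon_hom hn).pow s⟩
    have h := bigMon_mem (K := K) hn
    simp only [symbPow, Ideal.mem_iInf] at h ⊢
    intro P hP
    exact Ideal.pow_mem_pow (Ideal.pow_le_self (by omega) (h P hP)) s
  obtain ⟨f, hf, hf0, hhom⟩ := Nat.sInf_mem hne
  change f.IsHomogeneous (alpha (symbPow (sfBorel K n (Finset.Icc i (i + l))) s)) at hhom
  generalize alpha (symbPow (sfBorel K n (Finset.Icc i (i + l))) s) = d at hhom ⊢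
  obtain ⟨m, hm⟩ := Finset.nonempty_iff_ne_empty.mpr (mt support_eq_empty.mp hf0)
  obtain ⟨T, hT, hTc, hle⟩ := exists_small (fun j => m j) i hi l _ (card_firstVars hn)
  simp only [symbPow, Ideal.mem_iInf] at hf
  have hs := PT_pow_weight (hf _ (PT_minimal hi hn hT hTc)) hm
  have hd : ∑ j ∈ firstVars n (i + l), m j ≤ d := by
    have h1 : d = ∑ j ∈ m.support, m j := hhom.degree_eq_sum_deg_support hm
    rw [h1, Finset.sum_subset (Finset.subset_univ m.support) (by simp)]
    exact Finset.sum_le_sum_of_subset (Finset.subset_univ _)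
  calc (i + l) * s ≤ (i + l) * ∑ j ∈ T, m j := Nat.mul_le_mul_left _ hs
    _ ≤ i * ∑ j ∈ firstVars n (i + l), m j := hle
    _ ≤ i * d := Nat.mul_le_mul_left _ hd

end SFB

open SFB in
/-- Corollary 4.2 (first part): `ᾱ(sfBorel(x_i x_{i+1} ⋯ x_{i+l})) = (i+l)/i`. -/
theorem statement7 (K : Type*) [Field K] (n i l : ℕ)
    (hi : 1 ≤ i) (hn : i + l ≤ n) :
    waldschmidt (sfBorel K n (Finset.Icc i (i + l))) =
      ((i : ℝ) + (l : ℝ)) / (i : ℝ) := by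
  have hi0 : (0 : ℝ) < i := by exact_mod_cast hi
  apply le_antisymm
  · have hbdd : BddBelow (Set.range fun s : ℕ+ =>
        (alpha (symbPow (sfBorel K n (Finset.Icc i (i + l))) (s : ℕ)) : ℝ) / ((s : ℕ) : ℝ)) :=
      ⟨0, by rintro _ ⟨s, rfl⟩; positivity⟩
    refine (ciInf_le hbdd ⟨i, hi⟩).trans ?_
    have h : alpha (symbPow (sfBorel K n (Finset.Icc i (i + l))) i) ≤ i + l :=
      Nat.sInf_le ⟨bigMon K n (i + l), bigMon_mem hn, bigMon_ne _, bigMon_hom hn⟩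
    have h' : (alpha (symbPow (sfBorel K n (Finset.Icc i (i + l))) i) : ℝ) ≤ (i : ℝ) + l := by
      exact_mod_cast h
    exact div_le_div_of_nonneg_right h' hi0.le
  · refine le_ciInf fun s => ?_
    have hs0 : (0 : ℝ) < ((s : ℕ) : ℝ) := by exact_mod_cast s.pos
    rw [div_le_div_iff₀ hi0 hs0, mul_comm _ (i : ℝ)]
    exact_mod_cast alpha_lower (K := K) hi hn (s : ℕ)
end

section
/- Let m = x_{i_1}⋯x_{i_s} be a square-free monomial in S = K[x_1,…,x_n] with i_1 < ⋯ < i_s ≤ n, with T(m) = (t_0,…,t_k), IT(m) = (i_{t_0},…,i_{t_k}), and ℓ the unique index with i_{t_{ℓ+1}} < t_0 ≤ i_{t_ℓ} (convention i_{t_{k+1}} = 0). Assume ℓ < k, and set ν = i_{t_{ℓ+1}} + 1 (note ν ≤ s). Then ᾱ(sfBorel(m)) ≥ ᾱ(sfBorel(x_{i_1}⋯x_{i_{t_{ℓ+1}}})) + 1 + (t_0 − ν)/(i_ν − ν + 1), where x_{i_1}⋯x_{i_{t_{ℓ+1}}} is the product of the first t_{ℓ+1} variables dividing m and i_ν is the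 ν-th smallest index in the support of m. -/
open MvPolynomial

namespace SFB

/-! ### Averaging -/

lemma exists_subset_avg (g : ℕ → ℝ) (E : Finset ℕ) (d : ℕ) (hd : d ≤ E.card) :
    ∃ D ⊆ E, D.card = d ∧ (d : ℝ) * ∑ x ∈ E, g x ≤ (E.card : ℝ) * ∑ x ∈ D, g x := by
  obtain ⟨e, he⟩ := Nat.exists_eq_add_of_le hd
  induction e generalizing E with
  | zero => exact ⟨E, subset_rfl, by omega, by rw [he]; simp⟩
  | succ e ih =>
    have hne : E.Nonempty := by
      rw [← Finset.card_pos]; omega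
    obtain ⟨x, hx, hmin⟩ := E.exists_min_image g hne
    have hc : (E.erase x).card = d + e := by
      rw [Finset.card_erase_of_mem hx]; omega
    obtain ⟨D, hD, hDc, hDs⟩ := ih (E.erase x) (by omega) hc
    refine ⟨D, hD.trans (Finset.erase_subset _ _), hDc, ?_⟩
    have hsum : ∑ y ∈ E.erase x, g y + g x = ∑ y ∈ E, g y := Finset.sum_erase_add _ _ hx
    have h1 : (E.card : ℝ) * g x ≤ ∑ y ∈ E, g y := by
      have := Finset.card_nsmul_le_sum E g (g x) hmin
      simpa using this
    have h2 : (D.card : ℝ) * g x ≤ ∑ y ∈ D, g y := by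
      have := Finset.card_nsmul_le_sum D g (g x)
        (fun y hy => hmin y (Finset.mem_of_mem_erase (hD hy)))
      simpa using this
    rw [hc] at hDs
    rw [hDc] at h2
    rw [he]
    push_cast at hDs ⊢
    rw [← hsum]
    linarith

/-! ### Ideals of variables -/

noncomputable def kill (K : Type*) [Field K] (n : ℕ) (C : Finset ℕ) :
    MvPolynomial (Fin n) K →ₐ[K] MvPolynomial (Fin n) K :=
  aeval (fun j : Fin n => if (j : ℕ) + 1 ∈ C then 0 else X j)

lemma sub_kill_mem (K : Type*) [Field K] (n : ℕ) (C : Finset ℕ) (f : MvPolynomial (Fin n) K) :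
    f - kill K n C f ∈ Ideal.span (X '' {j : Fin n | (j : ℕ) + 1 ∈ C} :
      Set (MvPolynomial (Fin n) K)) := by
  induction f using MvPolynomial.induction_on with
  | C a => simp [kill, MvPolynomial.algebraMap_eq]
  | add p q hp hq =>
    have := Ideal.add_mem _ hp hq
    rw [map_add]
    convert this using 1
    ring
  | mul_X p j hp =>
    rw [map_mul]
    by_cases hj : (j : ℕ) + 1 ∈ C
    · have : kill K n C (X j) = 0 := by simp [kill, hj]
      rw [this, mul_zero, sub_zero]
      exact Ideal.mul_mem_left _ _ (Ideal.subset_span ⟨j, hj, rfl⟩)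
    · have : kill K n C (X j) = X j := by simp [kill, hj]
      rw [this, ← sub_mul]
      exact Ideal.mul_mem_right _ _ hp

lemma ker_kill_le (K : Type*) [Field K] (n : ℕ) (C : Finset ℕ) :
    RingHom.ker (kill K n C) ≤ Ideal.span (X '' {j : Fin n | (j : ℕ) + 1 ∈ C} :
      Set (MvPolynomial (Fin n) K)) := by
  intro f hf
  have := sub_kill_mem K n C f
  rw [RingHom.mem_ker] at hf
  rwa [hf, sub_zero] at this

/-- degree of an exponent vector in the variables from `C` -/
def cdeg {n : ℕ} (C : Finset ℕ) (a : Fin n →₀ ℕ) : ℕ :=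
  ∑ j : Fin n, if (j : ℕ) + 1 ∈ C then a j else 0

lemma cdeg_add {n : ℕ} (C : Finset ℕ) (a b : Fin n →₀ ℕ) :
    cdeg C (a + b) = cdeg C a + cdeg C b := by
  unfold cdeg
  rw [← Finset.sum_add_distrib]
  refine Finset.sum_congr rfl fun j _ => ?_
  split_ifs <;> simp

lemma cdeg_mono {n : ℕ} (C : Finset ℕ) {a b : Fin n →₀ ℕ} (h : a ≤ b) :
    cdeg C a ≤ cdeg C b := by
  unfold cdeg
  refine Finset.sum_le_sum fun j _ => ?_
  split_ifs
  · exact h j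
  · exact le_rfl

lemma span_pow_le (K : Type*) [Field K] (n : ℕ) (C : Finset ℕ) (q : ℕ) :
    (Ideal.span (X '' {j : Fin n | (j : ℕ) + 1 ∈ C} : Set (MvPolynomial (Fin n) K))) ^ q ≤
      Ideal.span ((fun a => monomial a (1 : K)) '' {a : Fin n →₀ ℕ | q ≤ cdeg C a}) := by
  induction q with
  | zero =>
    intro f _
    rw [mem_ideal_span_monomial_image]
    intro a _
    exact ⟨a, by simp, le_rfl⟩
  | succ q ih =>
    rw [pow_succ]
    refine (Ideal.mul_mono_left ih).trans ?_
    rw [Ideal.span_mul_span', Ideal.span_le]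
    rintro _ ⟨_, ⟨a, ha, rfl⟩, _, ⟨j, hj, rfl⟩, rfl⟩
    refine Ideal.subset_span ⟨a + Finsupp.single j 1, ?_, ?_⟩
    · simp only [Set.mem_ofPred_eq] at ha hj ⊢
      rw [cdeg_add]
      have : 1 ≤ cdeg C (Finsupp.single j 1) := by
        unfold cdeg
        refine le_trans ?_ (Finset.single_le_sum (fun _ _ => Nat.zero_le _) (Finset.mem_univ j))
        simp [hj]
      omega
    · simp [X, monomial_mul]

lemma le_cdeg_of_mem {K : Type*} [Field K] {n : ℕ} (I : Ideal (MvPolynomial (Fin n) K))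
    (C : Finset ℕ) (hC : I ≤ RingHom.ker (kill K n C)) (q : ℕ) (f : MvPolynomial (Fin n) K)
    (hf : f ∈ symbPow I q) (a : Fin n →₀ ℕ) (ha : a ∈ f.support) : q ≤ cdeg C a := by
  have hp : (RingHom.ker (kill K n C)).IsPrime := RingHom.ker_isPrime _
  obtain ⟨P, hP, hPle⟩ := Ideal.exists_minimalPrimes_le hC
  have h1 : f ∈ P ^ q := by
    unfold symbPow at hf
    simp only [Ideal.mem_iInf] at hf
    exact hf P hP
  have h2 := span_pow_le K n C q
    (Ideal.pow_right_mono (ker_kill_le K n C) q (Ideal.pow_right_mono hPle q h1))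
  rw [mem_ideal_span_monomial_image] at h2
  obtain ⟨b, hb, hba⟩ := h2 a ha
  exact le_trans hb (cdeg_mono C hba)

/-! ### Borel moves -/

lemma reach_sub {A A' B : Finset ℕ} (hA : A' ⊆ A) (h : BorelReach A B) :
    ∃ B' ⊆ B, BorelReach A' B' := by
  induction h with
  | refl => exact ⟨A', hA, Relation.ReflTransGen.refl⟩
  | tail _ hm ih =>
    obtain ⟨B', hB', hr⟩ := ih
    obtain ⟨x, hx, j, hj1, hjx, hj, rfl⟩ := hm
    by_cases hxB : x ∈ B'
    · refine ⟨insert j (B'.erase x), ?_, hr.tail ⟨x, hxB, j, hj1, hjx, fun h => hj (hB' h), rfl⟩⟩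
      exact Finset.insert_subset_insert _ (Finset.erase_subset_erase _ hB')
    · refine ⟨B', ?_, hr⟩
      intro y hy
      refine Finset.mem_insert_of_mem (Finset.mem_erase.2 ⟨?_, hB' hy⟩)
      rintro rfl
      exact hxB hy

lemma reach_bound {A B : Finset ℕ} {u : ℕ} (hA : ∀ x ∈ A, x ≤ u) (h : BorelReach A B) :
    ∀ x ∈ B, x ≤ u := by
  induction h with
  | refl => exact hA
  | tail _ hm ih =>
    obtain ⟨x, hx, j, hj1, hjx, hj, rfl⟩ := hm
    intro y hy
    rcases Finset.mem_insert.1 hy with rfl | hy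
    · exact hjx.le.trans (ih x hx)
    · exact ih y (Finset.mem_of_mem_erase hy)

lemma reach_count_s9 {A B : Finset ℕ} {v r : ℕ} (hA : r ≤ (A ∩ Finset.Icc 1 v).card)
    (h : BorelReach A B) : r ≤ (B ∩ Finset.Icc 1 v).card := by
  induction h with
  | refl => exact hA
  | @tail B B2 _ hm ih =>
    obtain ⟨x, hx, j, hj1, hjx, hj, rfl⟩ := hm
    refine ih.trans ?_
    by_cases hxv : x ≤ v
    · have hsub : insert j ((B ∩ Finset.Icc 1 v).erase x) ⊆
          insert j (B.erase x) ∩ Finset.Icc 1 v := by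
        intro y hy
        simp only [Finset.mem_insert, Finset.mem_erase, Finset.mem_inter, Finset.mem_Icc] at hy ⊢
        rcases hy with rfl | hy
        · exact ⟨Or.inl rfl, hj1, by omega⟩
        · exact ⟨Or.inr ⟨hy.1, hy.2.1⟩, hy.2.2⟩
      refine le_trans ?_ (Finset.card_le_card hsub)
      rw [Finset.card_insert_of_notMem (by simp [hj]),
        Finset.card_erase_of_mem (by simp [hx]; omega)]
      omega
    · refine Finset.card_le_card ?_
      intro y hy
      simp only [Finset.mem_insert, Finset.mem_erase, Finset.mem_inter, Finset.mem_Icc] at hy ⊢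
      refine ⟨Or.inr ⟨?_, hy.1⟩, hy.2⟩
      rintro rfl
      omega

lemma sfBorel_le_ker (K : Type*) [Field K] (n : ℕ) (A C : Finset ℕ) (hCn : C ⊆ Finset.Icc 1 n)
    (h : ∀ B, BorelReach A B → ∃ x ∈ B, x ∈ C) :
    sfBorel K n A ≤ RingHom.ker (kill K n C) := by
  unfold sfBorel
  rw [Ideal.span_le]
  rintro _ ⟨B, hB, rfl⟩
  obtain ⟨x, hxB, hxC⟩ := h B hB
  have hx := Finset.mem_Icc.1 (hCn hxC)
  have hx1 : x - 1 + 1 = x := by omega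
  change sqfMon K n B ∈ RingHom.ker (kill K n C)
  rw [RingHom.mem_ker]
  unfold sqfMon
  rw [map_prod]
  refine Finset.prod_eq_zero (Finset.mem_univ (⟨x - 1, by omega⟩ : Fin n)) ?_
  simp [hx1, hxB, hxC, kill]

/-! ### Membership in symbolic powers -/

lemma monomial_mem_pow {K : Type*} [Field K] {n : ℕ} (P : Ideal (MvPolynomial (Fin n) K))
    (C : Finset ℕ) (hC : ∀ j : Fin n, (j : ℕ) + 1 ∈ C → X j ∈ P) (a : Fin n →₀ ℕ) (q : ℕ)
    (hq : q ≤ cdeg C a) : monomial a (1 : K) ∈ P ^ q := by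
  refine Ideal.pow_le_pow_right hq ?_
  rw [monomial_eq, C_1, one_mul, Finsupp.prod_fintype _ _ (fun _ => pow_zero _)]
  unfold cdeg
  rw [← Finset.prod_pow_eq_pow_sum]
  refine Ideal.prod_mem_prod fun j _ => ?_
  split_ifs with h
  · exact Ideal.pow_mem_pow (hC j h) _
  · simp

lemma alpha_le_of_cdeg {K : Type*} [Field K] {n : ℕ} (I : Ideal (MvPolynomial (Fin n) K))
    (q : ℕ) (a : Fin n →₀ ℕ)
    (h : ∀ P ∈ I.minimalPrimes, ∃ C : Finset ℕ, (∀ j : Fin n, (j : ℕ) + 1 ∈ C → X j ∈ P) ∧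
      q ≤ cdeg C a) : alpha (symbPow I q) ≤ a.degree := by
  refine Nat.sInf_le ⟨monomial a 1, ?_, ?_, isHomogeneous_monomial _ rfl⟩
  · unfold symbPow
    simp only [Ideal.mem_iInf]
    intro P hP
    obtain ⟨C, hC, hq⟩ := h P hP
    exact monomial_mem_pow P C hC a q hq
  · simp

lemma alpha_set_nonempty (K : Type*) [Field K] (n : ℕ) (A : Finset ℕ) (q : ℕ) :
    {d | ∃ f ∈ symbPow (sfBorel K n A) q, f ≠ 0 ∧ MvPolynomial.IsHomogeneous f d}.Nonempty := by
  have hhom : (sqfMon K n A).IsHomogeneous (∑ j : Fin n, if (j : ℕ) + 1 ∈ A then 1 else 0) := by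
    unfold sqfMon
    refine IsHomogeneous.prod _ _ _ fun j _ => ?_
    split_ifs
    · exact isHomogeneous_X _ _
    · exact isHomogeneous_one _ _
  refine ⟨_, sqfMon K n A ^ q, ?_, ?_, hhom.pow q⟩
  · unfold symbPow
    simp only [Ideal.mem_iInf]
    intro P hP
    refine Ideal.pow_mem_pow (hP.1.2 ?_) q
    exact Ideal.subset_span ⟨A, Relation.ReflTransGen.refl, rfl⟩
  · refine pow_ne_zero _ ?_
    unfold sqfMon
    refine Finset.prod_ne_zero_iff.2 fun j _ => ?_
    split_ifs
    · exact X_ne_zero j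
    · exact one_ne_zero

/-! ### Exponent vectors as functions on `ℕ` -/

/-- the exponent of `x_r` -/
noncomputable def ext {n : ℕ} (a : Fin n →₀ ℕ) (r : ℕ) : ℝ :=
  if h : 1 ≤ r ∧ r ≤ n then (a ⟨r - 1, by omega⟩ : ℝ) else 0

lemma ext_nonneg {n : ℕ} (a : Fin n →₀ ℕ) (r : ℕ) : 0 ≤ ext a r := by
  unfold ext
  split_ifs <;> simp

lemma cdeg_eq {n : ℕ} (C : Finset ℕ) (hC : C ⊆ Finset.Icc 1 n) (a : Fin n →₀ ℕ) :
    (cdeg C a : ℝ) = ∑ r ∈ C, ext a r := by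
  unfold cdeg
  push_cast
  rw [← Finset.sum_filter]
  refine Finset.sum_bij (fun (j : Fin n) _ => (j : ℕ) + 1) ?_ ?_ ?_ ?_
  · intro j hj
    exact (Finset.mem_filter.1 hj).2
  · intro j _ j' _ h
    exact Fin.ext (by omega)
  · intro r hr
    have := Finset.mem_Icc.1 (hC hr)
    exact ⟨⟨r - 1, by omega⟩, by simp [show r - 1 + 1 = r by omega, hr],
      show r - 1 + 1 = r by omega⟩
  · intro j _
    unfold ext
    rw [dif_pos ⟨by omega, by omega⟩]
    simp

/-- restriction of an exponent vector to the first `u` variables -/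
noncomputable def restr {n : ℕ} (u : ℕ) (a : Fin n →₀ ℕ) : Fin n →₀ ℕ :=
  Finsupp.equivFunOnFinite.symm (fun j => if (j : ℕ) + 1 ≤ u then a j else 0)

lemma restr_degree {n : ℕ} (u : ℕ) (a : Fin n →₀ ℕ) :
    (restr u a).degree = cdeg (Finset.Icc 1 u) a := by
  rw [Finsupp.degree_eq_sum]
  unfold cdeg restr
  refine Finset.sum_congr rfl fun j _ => ?_
  simp

lemma cdeg_restr {n : ℕ} (u : ℕ) (a : Fin n →₀ ℕ) (C : Finset ℕ) (hC : ∀ x ∈ C, x ≤ u) :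
    cdeg C (restr u a) = cdeg C a := by
  unfold cdeg restr
  refine Finset.sum_congr rfl fun j _ => ?_
  split_ifs with h
  · have := hC _ h
    simp
    omega
  · rfl

lemma cdeg_le_degree {n : ℕ} (C : Finset ℕ) (a : Fin n →₀ ℕ) : cdeg C a ≤ a.degree := by
  rw [Finsupp.degree_eq_sum]
  unfold cdeg
  refine Finset.sum_le_sum fun j _ => ?_
  split_ifs <;> simp

/-- The restriction step: passing from `A` to a subset `A'` supported in `[1,u]`. -/
lemma alpha_restr {K : Type*} [Field K] {n : ℕ} (A A' : Finset ℕ) (hA : A' ⊆ A) (u q : ℕ)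
    (hu : ∀ x ∈ A', x ≤ u) (f : MvPolynomial (Fin n) K)
    (hf : f ∈ symbPow (sfBorel K n A) q) (a : Fin n →₀ ℕ) (ha : a ∈ f.support) :
    alpha (symbPow (sfBorel K n A') q) ≤ cdeg (Finset.Icc 1 u) a := by
  classical
  rw [← restr_degree]
  refine alpha_le_of_cdeg _ q _ fun P hP => ?_
  let C : Finset ℕ := Finset.image (fun j : Fin n => (j : ℕ) + 1) (Finset.univ.filter fun j : Fin n => (X j : MvPolynomial (Fin n) K) ∈ P ∧
    (j : ℕ) + 1 ≤ u)
  have hCmem : ∀ j : Fin n, (j : ℕ) + 1 ∈ C ↔ X j ∈ P ∧ (j : ℕ) + 1 ≤ u := by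
    intro j
    simp only [C, Finset.mem_image, Finset.mem_filter, Finset.mem_univ, true_and]
    constructor
    · rintro ⟨j', h, hj⟩
      obtain rfl : j' = j := Fin.ext (by omega)
      exact h
    · exact fun h => ⟨j, h, rfl⟩
  have hCu : ∀ x ∈ C, x ≤ u := by
    intro x hx
    simp only [C, Finset.mem_image, Finset.mem_filter, Finset.mem_univ, true_and] at hx
    obtain ⟨j, h, rfl⟩ := hx
    exact h.2
  have hCn : C ⊆ Finset.Icc 1 n := by
    intro x hx
    simp only [C, Finset.mem_image, Finset.mem_filter, Finset.mem_univ, true_and] at hx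
    obtain ⟨j, h, rfl⟩ := hx
    exact Finset.mem_Icc.2 ⟨by omega, by omega⟩
  refine ⟨C, fun j hj => ((hCmem j).1 hj).1, ?_⟩
  rw [cdeg_restr u a C hCu]
  refine le_cdeg_of_mem _ C (sfBorel_le_ker K n A C hCn ?_) q f hf a ha
  intro B hB
  obtain ⟨B', hB', hr⟩ := reach_sub hA hB
  have hbd := reach_bound hu hr
  have hPp : P.IsPrime := hP.1.1
  have hmem : sqfMon K n B' ∈ P := hP.1.2 (Ideal.subset_span ⟨B', hr, rfl⟩)
  unfold sqfMon at hmem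
  obtain ⟨j, -, hj⟩ := (Ideal.IsPrime.prod_mem_iff (p := P)).1 hmem
  split_ifs at hj with hjB
  · exact ⟨_, hB' hjB, (hCmem j).2 ⟨hj, hbd _ hjB⟩⟩
  · exact absurd ((Ideal.eq_top_iff_one _).2 hj) hPp.ne_top

end SFB

open SFB in
/-- Theorem 4.5: recursive lower bound for the Waldschmidt constant.
Here `ν = i_{t_{ℓ+1}} + 1`. -/
theorem statement9 (K : Type*) [Field K] (n s k ℓ ν : ℕ) (i t : ℕ → ℕ)
    (hs : 1 ≤ s)
    (hmono : ∀ r, 1 ≤ r → r < s → i r < i (r + 1))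
    (h1 : 1 ≤ i 1) (hn : i s ≤ n)
    (hT : IsTSeq s i t k)
    (hℓk : ℓ < k)
    (hℓ1 : t 0 ≤ i (t ℓ))
    (hℓ2 : i (t (ℓ + 1)) < t 0)
    (hν : ν = i (t (ℓ + 1)) + 1) :
    waldschmidt (sfBorel K n ((Finset.Icc 1 (t (ℓ + 1))).image i))
      + 1 + ((t 0 : ℝ) - (ν : ℝ)) / ((i ν : ℝ) - (ν : ℝ) + 1)
    ≤ waldschmidt (sfBorel K n ((Finset.Icc 1 s).image i)) := by
  have ht0 : t 0 = s := hT.1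
  obtain ⟨-, hT2, -⟩ := hT
  have hstep : ∀ j, j < k → t (j + 1) < t j := fun j hj => (hT2 (j + 1) (by omega) (by omega)).2.1
  have htle : ∀ j, j ≤ k → t j ≤ s := by
    intro j
    induction j with
    | zero => intro _; omega
    | succ j ih =>
      intro hj
      have := hstep j (by omega)
      have := ih (by omega)
      omega
  obtain ⟨hp1, hpt, -, hcons⟩ := hT2 (ℓ + 1) (by omega) (by omega)
  simp only [Nat.add_sub_cancel] at hpt hcons
  have htℓ := htle ℓ hℓk.le
  set p := t (ℓ + 1) with hp
  set T := t ℓ with hTdef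
  rw [ht0] at hℓ1 hℓ2 ⊢
  -- growth of `i`
  have hgrow : ∀ d r, 1 ≤ r → r + d ≤ s → i r + d ≤ i (r + d) := by
    intro d
    induction d with
    | zero => intros; simp
    | succ d ih =>
      intro r hr hrd
      have h1 := ih r hr (by omega)
      have h2 := hmono (r + d) (by omega) (by omega)
      have h0 : i (r + (d + 1)) = i (r + d + 1) := rfl
      omega
  have hgrow' : ∀ r r', 1 ≤ r → r ≤ r' → r' ≤ s → i r + (r' - r) ≤ i r' := by
    intro r r' hr hrr hr'
    have := hgrow (r' - r) r hr (by omega)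
    rwa [show r + (r' - r) = r' by omega] at this
  have hge : ∀ r, 1 ≤ r → r ≤ s → r ≤ i r := by
    intro r hr hrs
    have := hgrow' 1 r le_rfl hr hrs
    omega
  have hconst : ∀ d r, p < r → r + d ≤ T → i (r + d) = i r + d := by
    intro d
    induction d with
    | zero => intros; simp
    | succ d ih =>
      intro r hr hrd
      have h1 := ih r hr (by omega)
      have h2 := hcons (r + d) (by omega) (by omega)
      have h3 := hmono (r + d) (by omega) (by omega)
      have h0 : i (r + (d + 1)) = i (r + d + 1) := rfl
      omega
  have hpp := hge p hp1 (by omega)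
  have hνs : ν ≤ s := by omega
  have hν1 : 1 ≤ ν := by omega
  obtain ⟨R, hνR, hRs, hiR, hRc⟩ : ∃ R, ν ≤ R ∧ R ≤ s ∧ s ≤ i R ∧ i R + ν = i ν + R := by
    rcases le_total ν T with h | h
    · refine ⟨T, h, htℓ, hℓ1, ?_⟩
      have := hconst (T - ν) ν (by omega) (by omega)
      rw [show ν + (T - ν) = T by omega] at this
      omega
    · refine ⟨ν, le_rfl, hνs, ?_, rfl⟩
      have := hgrow' T ν (by omega) h hνs
      omega
  have hνi := hge ν hν1 hνs
  have hiRs := hgrow' R s (by omega) hRs le_rfl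
  -- reduce to a single exponent vector
  refine le_ciInf fun q => ?_
  set A := (Finset.Icc 1 s).image i with hA
  set A' := (Finset.Icc 1 p).image i with hA'
  have hqpos : (0 : ℝ) < ((q : ℕ) : ℝ) := by exact_mod_cast q.pos
  have hW : waldschmidt (sfBorel K n A') ≤
      (alpha (symbPow (sfBorel K n A') (q : ℕ)) : ℝ) / ((q : ℕ) : ℝ) := by
    unfold waldschmidt
    refine ciInf_le ⟨0, ?_⟩ q
    rintro _ ⟨x, rfl⟩
    positivity
  obtain ⟨f, hf, hf0, hfh⟩ := Nat.sInf_mem (alpha_set_nonempty K n A q)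
  obtain ⟨a, ha⟩ := MvPolynomial.ne_zero_iff.1 hf0
  have hdeg : a.degree = alpha (symbPow (sfBorel K n A) (q : ℕ)) := by
    by_contra hne
    exact ha (hfh.coeff_eq_zero hne)
  have hasup : a ∈ f.support := mem_support_iff.2 ha
  rw [← hdeg]
  have hsubA : A' ⊆ A := Finset.image_subset_image (Finset.Icc_subset_Icc le_rfl (by omega))
  have hbd : ∀ x ∈ A', x ≤ i p := by
    intro x hx
    obtain ⟨r, hr, rfl⟩ := Finset.mem_image.1 hx
    have hr := Finset.mem_Icc.1 hr
    have := hgrow' r p hr.1 hr.2 (by omega)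
    omega
  have hα := alpha_restr A A' hsubA (i p) q hbd f hf a hasup
  -- key inequality
  have key : ∀ r, 1 ≤ r → r ≤ s → ∀ C ⊆ Finset.Icc 1 (i r), C.card + r = i r + 1 →
      ((q : ℕ) : ℝ) ≤ ∑ x ∈ C, ext a x := by
    intro r hr hrs C hC hcard
    have hirs := hgrow' r s hr hrs le_rfl
    have hCn : C ⊆ Finset.Icc 1 n := hC.trans (Finset.Icc_subset_Icc le_rfl (by omega))
    rw [← cdeg_eq C hCn a]
    have : (q : ℕ) ≤ cdeg C a := by
      refine le_cdeg_of_mem _ C (sfBorel_le_ker K n A C hCn ?_) q f hf a hasup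
      intro B hB
      have hcA : r ≤ (A ∩ Finset.Icc 1 (i r)).card := by
        have hinj : Set.InjOn i (Finset.Icc 1 r : Finset ℕ) := by
          intro x hx y hy hxy
          simp only [Finset.coe_Icc, Set.mem_Icc] at hx hy
          rcases le_total x y with h | h
          · have := hgrow' x y hx.1 h (by omega)
            omega
          · have := hgrow' y x hy.1 h (by omega)
            omega
        have hc : ((Finset.Icc 1 r).image i).card = r := by
          rw [Finset.card_image_of_injOn hinj]; simp
        rw [← hc]
        refine (Finset.card_le_card ?_)
        rw [hc]
        intro x hx
        obtain ⟨y, hy, rfl⟩ := Finset.mem_image.1 hx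
        have hy := Finset.mem_Icc.1 hy
        have h1 := hgrow' y r hy.1 hy.2 hrs
        have h2 := hge y hy.1 (by omega)
        exact Finset.mem_inter.2 ⟨Finset.mem_image.2 ⟨y, Finset.mem_Icc.2 ⟨hy.1, by omega⟩, rfl⟩,
          Finset.mem_Icc.2 ⟨by omega, by omega⟩⟩
      have hcB := reach_count_s9 hcA hB
      by_contra! hno
      have hdisj : Disjoint (B ∩ Finset.Icc 1 (i r)) C := by
        rw [Finset.disjoint_left]
        intro x hx hxC
        exact hno x (Finset.mem_inter.1 hx).1 hxC
      have hle := Finset.card_le_card (Finset.union_subset (Finset.inter_subset_right (s₁ := B)) hC)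
      rw [Finset.card_union_of_disjoint hdisj, Nat.card_Icc] at hle
      omega
    exact_mod_cast this
  -- the numerical argument
  have hE : (Finset.Icc ν (i R)).card = i R + 1 - ν := Nat.card_Icc _ _
  obtain ⟨D1, hD1, hD1c, hD1s⟩ := exists_subset_avg (ext a) (Finset.Icc ν (i R)) (R - ν) (by omega)
  obtain ⟨D, hD, hDc, hDs⟩ := exists_subset_avg (ext a) (Finset.Icc ν (i R)) (s - ν) (by omega)
  have hk1 := key R (by omega) hRs (Finset.Icc ν (i R) \ D1)
    (Finset.sdiff_subset.trans (Finset.Icc_subset_Icc hν1 le_rfl))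
    (by rw [Finset.card_sdiff_of_subset hD1]; omega)
  have hDs' : D ⊆ Finset.Icc ν (i s) := hD.trans (Finset.Icc_subset_Icc le_rfl (by omega))
  have hk2 := key s hs le_rfl (Finset.Icc ν (i s) \ D)
    (Finset.sdiff_subset.trans (Finset.Icc_subset_Icc hν1 le_rfl))
    (by rw [Finset.card_sdiff_of_subset hDs', Nat.card_Icc]; omega)
  have hs1 := Finset.sum_sdiff (f := ext a) hD1
  have hs2 := Finset.sum_sdiff (f := ext a) hDs'
  have htot : ∑ x ∈ Finset.Icc 1 (i p), ext a x + ∑ x ∈ Finset.Icc ν (i s), ext a x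
      ≤ (a.degree : ℝ) := by
    have hdj : Disjoint (Finset.Icc 1 (i p)) (Finset.Icc ν (i s)) := by
      rw [Finset.disjoint_left]
      intro x hx hx'
      simp only [Finset.mem_Icc] at hx hx'
      omega
    rw [← Finset.sum_union hdj, ← cdeg_eq]
    · exact_mod_cast cdeg_le_degree _ _
    · intro x hx
      simp only [Finset.mem_union, Finset.mem_Icc] at hx ⊢
      omega
  have hα' : (alpha (symbPow (sfBorel K n A') (q : ℕ)) : ℝ) ≤
      ∑ x ∈ Finset.Icc 1 (i p), ext a x := by
    rw [← cdeg_eq]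
    · exact_mod_cast hα
    · exact Finset.Icc_subset_Icc le_rfl (by omega)
  rw [hE] at hD1s hDs
  generalize ∑ x ∈ Finset.Icc ν (i R), ext a x = tot at *
  generalize ∑ x ∈ D, ext a x = sD at *
  generalize ∑ x ∈ D1, ext a x = sD1 at *
  have hMcast : ((i R + 1 - ν : ℕ) : ℝ) = (i R : ℝ) + 1 - ν := by
    rw [Nat.cast_sub (by omega)]; push_cast; ring
  have hMpos : (0 : ℝ) < (i R : ℝ) + 1 - ν := by
    rw [← hMcast]
    exact_mod_cast (by omega : 0 < i R + 1 - ν)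
  rw [hMcast, Nat.cast_sub (by omega)] at hD1s hDs
  have hRc' : (i R : ℝ) + ν = i ν + R := by exact_mod_cast hRc
  have hN : (0 : ℝ) < (i ν : ℝ) - ν + 1 := by
    have : (ν : ℝ) ≤ i ν := by exact_mod_cast hνi
    linarith
  have hsν : (0 : ℝ) ≤ (s : ℝ) - ν := by
    have : (ν : ℝ) ≤ s := by exact_mod_cast hνs
    linarith
  have hA1 : ((i R : ℝ) + 1 - ν) * ((q : ℕ) : ℝ) ≤ ((i ν : ℝ) - ν + 1) * tot := by
    have h1 := mul_le_mul_of_nonneg_left hk1 hMpos.le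
    have h2 : (i ν : ℝ) - ν + 1 = (i R + 1 - ν) - (R - ν) := by linarith
    rw [h2, sub_mul]
    rw [← hs1] at hD1s ⊢
    linarith
  have hA2 : ((s : ℝ) - ν) * ((q : ℕ) : ℝ) ≤ ((i ν : ℝ) - ν + 1) * sD := by
    refine le_of_mul_le_mul_left ?_ hMpos
    have h1 := mul_le_mul_of_nonneg_left hA1 hsν
    have h2 := mul_le_mul_of_nonneg_left hDs hN.le
    linarith
  have hA3 : ((s : ℝ) - ν) / ((i ν : ℝ) - ν + 1) * ((q : ℕ) : ℝ) ≤ sD := by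
    rw [div_mul_eq_mul_div, div_le_iff₀ hN]
    linarith
  rw [le_div_iff₀ hqpos] at hW ⊢
  linarith
end
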